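/- arXiv:1605.08538 — 3 statements merged into one kernel-verified Lean document; each statement's English description precedes it below -/
import Mathlib

section
/- Let d, ℓ, m ∈ ℕ and let 𝒫 be a finite family of polytopes in ℝ^d, each of dimension at least one, with 2 ≤ |𝒫| < ∞, such that every P ∈ 𝒫 has an extended formulation with ℓ LMIs of size m. Let ρ > 0 and Δ > 0 be such that every P ∈ 𝒫 is contained in the ball ρ·B^d, and for every two distinct P, P' ∈ 𝒫 one has dist(P, P') ≥ Δ. Then ℓ²·m⁴ ≥ log₂|𝒫| / (8·d·(1 + log₂(2ρ/Δ) + log₂ log₂ |𝒫|)). -/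
open Metric Set

noncomputable section

/-- A polytope: convex hull of a finite set. -/
def IsPolytope {d : ℕ} (P : Set (EuclideanSpace ℝ (Fin d))) : Prop :=
  ∃ V : Finset (EuclideanSpace ℝ (Fin d)), P = convexHull ℝ (V : Set (EuclideanSpace ℝ (Fin d)))

/-- `P` has an extended formulation with `l` LMIs of size `m`. -/
def HasSdpExtBlocks {d : ℕ} (P : Set (EuclideanSpace ℝ (Fin d))) (l m : ℕ) : Prop :=
  ∃ (n : ℕ) (φ : EuclideanSpace ℝ (Fin n) →ᵃ[ℝ] EuclideanSpace ℝ (Fin d))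
    (M : Fin l → (EuclideanSpace ℝ (Fin n) →ᵃ[ℝ] Matrix (Fin m) (Fin m) ℝ)),
    (∀ i x, (M i x).IsSymm) ∧ P = φ '' {x | ∀ i, (M i x).PosSemidef}

/-- `P` has an extended formulation with a single LMI of size `k`. -/
def HasSdpExt {d : ℕ} (P : Set (EuclideanSpace ℝ (Fin d))) (k : ℕ) : Prop :=
  ∃ (n : ℕ) (φ : EuclideanSpace ℝ (Fin n) →ᵃ[ℝ] EuclideanSpace ℝ (Fin d))
    (M : EuclideanSpace ℝ (Fin n) →ᵃ[ℝ] Matrix (Fin k) (Fin k) ℝ),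
    (∀ x, (M x).IsSymm) ∧ P = φ '' {x | (M x).PosSemidef}

/-- `P` has an extended formulation with `l` linear inequalities. -/
def HasLinExt {d : ℕ} (P : Set (EuclideanSpace ℝ (Fin d))) (l : ℕ) : Prop :=
  ∃ (n : ℕ) (φ : EuclideanSpace ℝ (Fin n) →ᵃ[ℝ] EuclideanSpace ℝ (Fin d))
    (a : Fin l → (EuclideanSpace ℝ (Fin n) →ᵃ[ℝ] ℝ)),
    P = φ '' {x | ∀ i, 0 ≤ a i x}

open Classical in
/-- Semidefinite extension complexity. -/
def sxc {d : ℕ} (P : Set (EuclideanSpace ℝ (Fin d))) : ℕ :=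
  if P = ∅ ∨ ∃ p, P = {p} then 0 else sInf {k | HasSdpExt P k}

open Classical in
/-- Linear extension complexity. -/
def xc {d : ℕ} (P : Set (EuclideanSpace ℝ (Fin d))) : ℕ :=
  if P = ∅ ∨ ∃ p, P = {p} then 0 else sInf {l | HasLinExt P l}

/-- Spectral norm of a square real matrix (the operator norm of the induced map
on Euclidean space; for a symmetric matrix this is the largest absolute value of
an eigenvalue). -/
def specNorm {ι : Type*} [Fintype ι] [DecidableEq ι] (T : Matrix ι ι ℝ) : ℝ :=
  ‖LinearMap.toContinuousLinearMap (Matrix.toEuclideanLin T)‖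

/-- Norm of a linear map into square matrices: the maximum of the spectral norm
of the values over the unit ball. -/
def lmNorm {n : ℕ} {ι : Type*} [Fintype ι] [DecidableEq ι]
    (A : EuclideanSpace ℝ (Fin n) →ₗ[ℝ] Matrix ι ι ℝ) : ℝ :=
  sSup {r | ∃ x : EuclideanSpace ℝ (Fin n), ‖x‖ ≤ 1 ∧ r = specNorm (A x)}

/-- A 0/1-polytope: the convex hull of a set of 0/1-vectors. -/
def IsZeroOnePolytope {d : ℕ} (P : Set (EuclideanSpace ℝ (Fin d))) : Prop :=
  ∃ V : Set (EuclideanSpace ℝ (Fin d)),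
    V ⊆ {x | ∀ i, x i = 0 ∨ x i = 1} ∧ P = convexHull ℝ V


lemma spanner_top {W ι : Type*} [AddCommGroup W] [Module ℝ W] [Finite ι]
    (w : ι → W) (hw : ⊤ ≤ Submodule.span ℝ (Set.range w)) :
    ∃ s : Fin (Module.finrank ℝ W) → ι, ∀ v, ∃ c : Fin (Module.finrank ℝ W) → ℝ,
      (∀ i, |c i| ≤ 1) ∧ w v = ∑ i, c i • w (s i) := by
  classical
  obtain ⟨κ, a, ha, hsp, hli⟩ := exists_linearIndependent' ℝ w
  have : Finite κ := Finite.of_injective a ha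
  have : Fintype κ := Fintype.ofFinite κ
  rw [← hsp] at hw
  let e0 : Module.Basis κ ℝ W := Module.Basis.mk hli hw
  let eq : κ ≃ Fin (Module.finrank ℝ W) :=
    Fintype.equivFinOfCardEq (Module.finrank_eq_card_basis e0).symm
  let e := e0.reindex eq
  have he : (e : Fin (Module.finrank ℝ W) → W) = w ∘ (a ∘ eq.symm) := by
    ext i; simp [e, e0]
  have : Nonempty (Fin (Module.finrank ℝ W) → ι) := ⟨a ∘ eq.symm⟩
  obtain ⟨s, hs⟩ := Finite.exists_max (fun s : Fin (Module.finrank ℝ W) → ι => |e.det (w ∘ s)|)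
  have h1 : 1 ≤ |e.det (w ∘ s)| := by
    have := hs (a ∘ eq.symm)
    rw [← he, e.det_self] at this
    simpa using this
  have hne : e.det (w ∘ s) ≠ 0 := by
    intro h; rw [h] at h1; norm_num at h1
  obtain ⟨hl, hsp'⟩ := (Module.Basis.is_basis_iff_det e).2 (isUnit_iff_ne_zero.2 hne)
  refine ⟨s, fun v => ⟨fun i => (Module.Basis.mk hl hsp'.ge).coord i (w v), fun i => ?_, ?_⟩⟩
  · have h2 := e.det_smul_mk_coord_eq_det_update hl hsp'.ge i
    have h3 := congrArg (fun f => f (w v)) h2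
    have h4 : Function.update (w ∘ s) i (w v) = w ∘ (Function.update s i v) := by
      rw [Function.comp_update]
    have h5 : e.det (w ∘ s) * (Module.Basis.mk hl hsp'.ge).coord i (w v)
        = e.det (w ∘ (Function.update s i v)) := by
      rw [← h4]; simpa using h3
    have h6 := hs (Function.update s i v)
    rw [← h5, abs_mul] at h6
    by_contra h7
    push Not at h7
    nlinarith
  · have := (Module.Basis.mk hl hsp'.ge).sum_repr (w v)
    conv_lhs => rw [← this]
    simp

lemma spanner {E ι : Type*} [AddCommGroup E] [Module ℝ E] [FiniteDimensional ℝ E] [Finite ι]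
    [Nonempty ι] (w : ι → E) (K : ℕ) (hK : Module.finrank ℝ E ≤ K) :
    ∃ s : Fin K → ι, ∀ v, ∃ c : Fin K → ℝ,
      (∀ i, |c i| ≤ 1) ∧ w v = ∑ i, c i • w (s i) := by
  classical
  let W := Submodule.span ℝ (Set.range w)
  let w' : ι → W := fun i => ⟨w i, Submodule.subset_span ⟨i, rfl⟩⟩
  have hw' : ⊤ ≤ Submodule.span ℝ (Set.range w') := by
    have := Submodule.span_range_subtype_eq_top_iff W (s := w)
      (fun i => Submodule.subset_span ⟨i, rfl⟩)
    exact (this.2 rfl).ge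
  obtain ⟨s, hs⟩ := spanner_top w' hw'
  have hle : Module.finrank ℝ W ≤ K := (Submodule.finrank_le W).trans hK
  let f := Fin.castLE hle
  have hf : Function.Injective f := Fin.castLE_injective hle
  refine ⟨Function.extend f s (fun _ => Classical.arbitrary ι), fun v => ?_⟩
  obtain ⟨c, hc, hv⟩ := hs v
  refine ⟨Function.extend f c 0, fun j => ?_, ?_⟩
  · by_cases h : ∃ i, f i = j
    · obtain ⟨i, rfl⟩ := h
      rw [hf.extend_apply]; exact hc i
    · rw [Function.extend_apply' _ _ _ h]; simp
  · have h1 : w v = ∑ i, c i • w (s i) := by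
      have := congrArg (Subtype.val) hv
      simpa [w'] using this
    rw [h1]
    refine Fintype.sum_of_injective f hf _ _ (fun j hj => ?_) (fun i => ?_)
    · rw [Function.extend_apply' _ _ _ (by simpa using hj)]; simp
    · rw [hf.extend_apply, hf.extend_apply]

lemma psd_two {m : ℕ} {M : Matrix (Fin m) (Fin m) ℝ} (hM : M.PosSemidef) (j k : Fin m) (s t : ℝ) :
    0 ≤ s ^ 2 * M j j + 2 * s * t * M j k + t ^ 2 * M k k := by
  have h := hM.dotProduct_mulVec_nonneg (Pi.single j s + Pi.single k t)
  have hsymm : M k j = M j k := by simpa using hM.1.apply j k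
  have e : star (Pi.single j s + Pi.single k t) ⬝ᵥ (M.mulVec (Pi.single j s + Pi.single k t))
      = s ^ 2 * M j j + 2 * s * t * M j k + t ^ 2 * M k k := by
    simp only [star_trivial, Matrix.mulVec_add, add_dotProduct, dotProduct_add,
      single_dotProduct, Matrix.mulVec_single, Pi.smul_apply, MulOpposite.smul_eq_mul_unop, MulOpposite.unop_op,
      Matrix.col_apply, hsymm]
    ring
  rwa [e] at h

lemma nf_matrix {m K : ℕ} (hK : 0 < K) (A : Fin K → Matrix (Fin m) (Fin m) ℝ)
    (hA : ∀ i, (A i).PosSemidef) :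
    ∃ T : Fin K → Matrix (Fin m) (Fin m) ℝ, (∀ i, (T i).PosSemidef) ∧ ∑ i, T i = 1 ∧
      ∀ c : Fin K → ℝ, ∑ i, c i = 1 →
        ((∑ i, c i • A i).PosSemidef ↔ (∑ i, c i • T i).PosSemidef) := by
  classical
  have hS : (∑ i, A i).PosSemidef := Matrix.posSemidef_sum _ (fun i _ => hA i)
  set S := ∑ i, A i with hSdef
  let U : Matrix (Fin m) (Fin m) ℝ := hS.1.eigenvectorUnitary
  let ev := hS.1.eigenvalues
  have hev : ∀ j, 0 ≤ ev j := hS.eigenvalues_nonneg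
  have hUS : star U * S * U = Matrix.diagonal ev := by
    have := hS.1.conjStarAlgAut_star_eigenvectorUnitary
    rw [Unitary.conjStarAlgAut_star_apply] at this
    simpa [U, ev] using this
  let g : Fin m → ℝ := fun j => if ev j = 0 then 1 else (Real.sqrt (ev j))⁻¹
  let D := U * Matrix.diagonal g
  have hg : ∀ j, g j ≠ 0 := by
    intro j
    by_cases h : ev j = 0
    · simp [g, h]
    · have : 0 < ev j := lt_of_le_of_ne (hev j) (Ne.symm h)
      simp [g, h, (Real.sqrt_pos.2 this).ne']
  have hD : IsUnit D := by
    refine IsUnit.mul ?_ ?_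
    · exact (Unitary.toUnits hS.1.eigenvectorUnitary).isUnit
    · rw [Matrix.isUnit_diagonal, Pi.isUnit_iff]
      exact fun j => isUnit_iff_ne_zero.2 (hg j)
  let q : Fin m → ℝ := fun j => if ev j = 0 then 0 else 1
  let E := Matrix.diagonal q
  have hDS : star D * S * D = E := by
    have : star D * S * D = Matrix.diagonal g * (star U * S * U) * Matrix.diagonal g := by
      simp only [D, star_mul, Matrix.star_eq_conjTranspose, Matrix.diagonal_conjTranspose,
        star_trivial, Matrix.mul_assoc]
    rw [this, hUS, Matrix.diagonal_mul_diagonal, Matrix.diagonal_mul_diagonal]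
    congr 1
    ext j
    by_cases h : ev j = 0
    · simp [q, h]
    · have h0 : 0 < ev j := lt_of_le_of_ne (hev j) (Ne.symm h)
      have h1 := Real.sqrt_pos.2 h0
      simp only [g, q, h, if_false]
      field_simp
      rw [Real.sq_sqrt h0.le]
  let A' : Fin K → Matrix (Fin m) (Fin m) ℝ := fun i => star D * A i * D
  have hA' : ∀ i, (A' i).PosSemidef := fun i => (hA i).conjTranspose_mul_mul_same D
  have hsumA' : ∑ i, A' i = E := by
    rw [← hDS, hSdef, Finset.mul_sum, Finset.sum_mul]
  have hK' : (0:ℝ) < K := by exact_mod_cast hK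
  let C : Matrix (Fin m) (Fin m) ℝ := Matrix.diagonal (fun j => 1 - q j)
  have hC : C.PosSemidef := by
    refine Matrix.PosSemidef.diagonal (fun j => ?_)
    by_cases h : ev j = 0 <;> simp [q, h]
  -- entries of A' vanish on the kernel indices
  have hdiag : ∀ i j, q j = 0 → A' i j j = 0 := by
    intro i j hj
    have h1 : ∑ i, A' i j j = 0 := by
      have := congrFun (congrFun hsumA' j) j
      rw [Matrix.sum_apply] at this
      rw [this]; simp [E, hj]
    exact (Finset.sum_eq_zero_iff_of_nonneg (fun i _ => (hA' i).diag_nonneg)).1 h1 i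
      (Finset.mem_univ i)
  have hEA : ∀ i, E * A' i * E = A' i := by
    intro i
    have hsymm : ∀ j k, A' i k j = A' i j k := fun j k => by simpa using (hA' i).1.apply j k
    have hz : ∀ j k, q j = 0 → A' i j k = 0 := by
      intro j k hj
      have h0 := hdiag i j hj
      have ha := psd_two (hA' i) j k (-(A' i k k + 1)) (A' i j k)
      have hb := (hA' i).diag_nonneg (i := k)
      rw [h0] at ha
      by_contra hne
      have : 0 < (A' i j k) ^ 2 := by positivity
      nlinarith [mul_nonneg hb (sq_nonneg (A' i j k))]
    ext j k
    simp only [E, Matrix.mul_diagonal, Matrix.diagonal_mul]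
    by_cases hj : ev j = 0
    · rw [hz j k (by simp [q, hj])]; simp
    · by_cases hk : ev k = 0
      · rw [← hsymm, hz k j (by simp [q, hk])]; simp
      · simp [q, hj, hk]
  have hCE : C * E = 0 := by
    simp only [C, E, Matrix.diagonal_mul_diagonal]
    rw [← Matrix.diagonal_zero]
    congr 1; ext j
    by_cases h : ev j = 0 <;> simp [q, h]
  refine ⟨fun i => A' i + (K:ℝ)⁻¹ • C, fun i => (hA' i).add (hC.smul (by positivity)), ?_, ?_⟩
  · rw [Finset.sum_add_distrib, hsumA']
    simp only [Finset.sum_const, Finset.card_univ, Fintype.card_fin, ← Nat.cast_smul_eq_nsmul ℝ,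
      smul_smul, mul_inv_cancel₀ hK'.ne', one_smul]
    simp only [E, C, Matrix.diagonal_add]
    simp
  · intro c hc
    have h1 : (∑ i, c i • A i).PosSemidef ↔ (∑ i, c i • A' i).PosSemidef := by
      rw [← Matrix.IsUnit.posSemidef_star_left_conjugate_iff hD]
      simp only [A', Finset.mul_sum, Finset.sum_mul, Matrix.mul_smul, Matrix.smul_mul]
    have h2 : ∑ i, c i • (A' i + (K:ℝ)⁻¹ • C) = ∑ i, c i • A' i + (K:ℝ)⁻¹ • C := by
      simp only [smul_add, Finset.sum_add_distrib, ← Finset.sum_smul, hc, one_smul]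
    rw [h1, h2]
    constructor
    · intro h
      exact h.add (hC.smul (by positivity))
    · intro h
      have h3 := h.conjTranspose_mul_mul_same E
      have hE : E.conjTranspose = E := by simp [E]
      rw [hE, Matrix.mul_add, Matrix.add_mul, Matrix.mul_smul, Matrix.smul_mul, Matrix.mul_assoc E C,
        hCE, Matrix.mul_zero, smul_zero, add_zero, Finset.mul_sum, Finset.sum_mul] at h3
      simpa only [Matrix.mul_smul, Matrix.smul_mul, hEA] using h3

/-- Normal form of an extended formulation. -/
def NF {d : ℕ} (K l m : ℕ) (P : Set (EuclideanSpace ℝ (Fin d)))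
    (T : Fin K → Fin l → Matrix (Fin m) (Fin m) ℝ) (p : Fin K → EuclideanSpace ℝ (Fin d)) : Prop :=
  (∀ b, ∑ i, T i b = 1) ∧ (∀ i b, (T i b).PosSemidef) ∧ (∀ i, p i ∈ P) ∧
  (∀ c : Fin K → ℝ, ∑ i, c i = 1 → (∀ b, (∑ i, c i • T i b).PosSemidef) → ∑ i, c i • p i ∈ P) ∧
  ∃ V : Finset (EuclideanSpace ℝ (Fin d)), P = convexHull ℝ (V : Set (EuclideanSpace ℝ (Fin d))) ∧
    ∀ v ∈ V, ∃ c : Fin K → ℝ, (∀ i, |c i| ≤ 1) ∧ ∑ i, c i = 1 ∧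
      (∀ b, (∑ i, c i • T i b).PosSemidef) ∧ v = ∑ i, c i • p i

lemma affine_comb {V W ι : Type*} [AddCommGroup V] [Module ℝ V] [AddCommGroup W] [Module ℝ W]
    [Fintype ι] (f : V →ᵃ[ℝ] W) (c : ι → ℝ) (hc : ∑ i, c i = 1) (x : ι → V) :
    f (∑ i, c i • x i) = ∑ i, c i • f (x i) := by
  have h : ∀ y, f y = f.linear y + f 0 := fun y => congrFun f.decomp y
  rw [h]
  simp_rw [fun i => h (x i)]
  simp [smul_add, Finset.sum_add_distrib, ← Finset.sum_smul, hc]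

lemma exists_NF {d l m : ℕ} (P : Set (EuclideanSpace ℝ (Fin d))) (hP : IsPolytope P)
    (hne : P.Nonempty) (hext : HasSdpExtBlocks P l m) :
    ∃ T p, NF (l * (m * m) + 1) l m P T p := by
  classical
  obtain ⟨V, hV⟩ := hP
  obtain ⟨n, φ, M, hsymm, hφ⟩ := hext
  have hVne : V.Nonempty := by
    rw [hV, convexHull_nonempty_iff] at hne
    exact_mod_cast hne
  have hbdd : Bornology.IsBounded P := by
    rw [hV]; exact (V.finite_toSet.isCompact_convexHull ℝ).isBounded
  have hpre : ∀ v : V, ∃ x, (∀ i, (M i x).PosSemidef) ∧ φ x = v := by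
    intro v
    have : (v : EuclideanSpace ℝ (Fin d)) ∈ P := by
      rw [hV]; exact subset_convexHull ℝ _ v.2
    rw [hφ] at this
    obtain ⟨x, hx, hxv⟩ := this
    exact ⟨x, hx, hxv⟩
  choose x hx hxv using hpre
  have : Nonempty V := hVne.to_subtype
  -- equal slack matrices give equal images
  have hinj : ∀ y z, (∀ i, (M i y).PosSemidef) → (∀ i, M i y = M i z) → φ y = φ z := by
    intro y z hy hyz
    by_contra hne
    have hmem : ∀ t : ℝ, φ y + t • (φ z - φ y) ∈ P := by
      intro t
      rw [hφ]
      refine ⟨AffineMap.lineMap y z t, fun i => ?_, ?_⟩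
      · rw [AffineMap.apply_lineMap, ← hyz]; simpa using hy i
      · rw [AffineMap.apply_lineMap, AffineMap.lineMap_apply]
        simp [add_comm]
    obtain ⟨R, hR⟩ := hbdd.exists_norm_le
    have hpos : 0 < ‖φ z - φ y‖ := norm_pos_iff.2 (sub_ne_zero.2 (Ne.symm hne))
    have h1 := hR _ (hmem 0)
    have h2 := hR _ (hmem ((2 * R + 1) / ‖φ z - φ y‖))
    have h3 : ‖((2 * R + 1) / ‖φ z - φ y‖) • (φ z - φ y)‖ ≤ 2 * R := by
      have := norm_sub_le (φ y + ((2 * R + 1) / ‖φ z - φ y‖) • (φ z - φ y)) (φ y)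
      simp only [zero_smul, add_zero] at h1
      rw [add_sub_cancel_left] at this
      linarith
    have hR0 : 0 ≤ R := (norm_nonneg _).trans h1
    rw [norm_smul, Real.norm_eq_abs, abs_of_nonneg (by positivity), div_mul_cancel₀ _ hpos.ne'] at h3
    linarith
  let w : V → (Fin l → Matrix (Fin m) (Fin m) ℝ) × ℝ := fun v => (fun i => M i (x v), 1)
  have hfr : Module.finrank ℝ ((Fin l → Matrix (Fin m) (Fin m) ℝ) × ℝ) ≤ l * (m * m) + 1 := by
    rw [Module.finrank_prod, Module.finrank_pi_fintype]
    simp [Module.finrank_matrix]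
  obtain ⟨s, hs⟩ := spanner w (l * (m * m) + 1) hfr
  have hnf := fun b => nf_matrix (Nat.succ_pos (l * (m * m))) (fun i => M b (x (s i)))
    (fun i => hx (s i) b)
  choose T hT1 hT2 hT3 using hnf
  refine ⟨fun i b => T b i, fun i => φ (x (s i)), fun b => hT2 b, fun i b => hT1 b i, ?_, ?_, V, hV, ?_⟩
  · intro i
    rw [hφ]; exact ⟨_, hx (s i), rfl⟩
  · intro c hc hpsd
    rw [hφ]
    refine ⟨∑ i, c i • x (s i), fun b => ?_, affine_comb φ c hc _⟩
    rw [affine_comb _ c hc]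
    exact (hT3 b c hc).2 (hpsd b)
  · intro v hv
    obtain ⟨c, hc1, hc2⟩ := hs ⟨v, hv⟩
    have hsum : ∑ i, c i = 1 := by
      have := congrArg Prod.snd hc2
      simpa [w, Prod.snd_sum] using this.symm
    have hM : ∀ b, M b (x ⟨v, hv⟩) = ∑ i, c i • M b (x (s i)) := by
      intro b
      have := congrFun (congrArg Prod.fst hc2) b
      simpa [w, Prod.fst_sum] using this
    refine ⟨c, hc1, hsum, fun b => ?_, ?_⟩
    · rw [← hT3 b c hsum, ← hM]; exact hx _ b
    · rw [← affine_comb φ c hsum]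
      refine (hxv ⟨v, hv⟩).symm.trans (hinj _ _ (hx _) (fun b => ?_))
      rw [affine_comb _ c hsum, hM]

lemma NF_entry {d K l m : ℕ} {P : Set (EuclideanSpace ℝ (Fin d))}
    {T : Fin K → Fin l → Matrix (Fin m) (Fin m) ℝ} {p : Fin K → EuclideanSpace ℝ (Fin d)}
    (h : NF K l m P T p) (i : Fin K) (b : Fin l) (j k : Fin m) : |T i b j k| ≤ 1 := by
  obtain ⟨h1, h2, -⟩ := h
  have hd : ∀ j, T i b j j ≤ 1 := by
    intro j
    have h3 : ∑ i, T i b j j = 1 := by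
      have := congrFun (congrFun (h1 b) j) j
      rw [Matrix.sum_apply] at this
      simpa using this
    rw [← h3]
    exact Finset.single_le_sum (f := fun i => T i b j j) (fun i _ => (h2 i b).diag_nonneg) (Finset.mem_univ i)
  have ha := psd_two (h2 i b) j k 1 1
  have hb := psd_two (h2 i b) j k 1 (-1)
  have := hd j
  have := hd k
  rw [abs_le]
  constructor <;> linarith

lemma quad_bound {m : ℕ} (M : Matrix (Fin m) (Fin m) ℝ) (η : ℝ) (hM : ∀ j k, |M j k| ≤ η)
    (v : Fin m → ℝ) : |v ⬝ᵥ (M.mulVec v)| ≤ m * η * (v ⬝ᵥ v) := by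
  have h1 : |v ⬝ᵥ (M.mulVec v)| ≤ η * (∑ j, |v j|) ^ 2 := by
    simp only [dotProduct, Matrix.mulVec, Finset.mul_sum]
    rw [sq, Finset.sum_mul_sum, Finset.mul_sum]
    refine (Finset.abs_sum_le_sum_abs _ _).trans (Finset.sum_le_sum fun j _ => ?_)
    rw [Finset.mul_sum]
    refine (Finset.abs_sum_le_sum_abs _ _).trans (Finset.sum_le_sum fun k _ => ?_)
    rw [abs_mul, abs_mul]
    have := mul_le_mul_of_nonneg_right (hM j k) (mul_nonneg (abs_nonneg (v j)) (abs_nonneg (v k)))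
    linarith
  have h2 : (∑ j, |v j|) ^ 2 ≤ m * (v ⬝ᵥ v) := by
    have := sq_sum_le_card_mul_sum_sq (s := Finset.univ) (f := fun j => |v j|)
    simpa [dotProduct, sq] using this
  rcases Nat.eq_zero_or_pos m with rfl | hm
  · simp
  · have hη : 0 ≤ η := (abs_nonneg _).trans (hM ⟨0, hm⟩ ⟨0, hm⟩)
    nlinarith [mul_le_mul_of_nonneg_left h2 hη]

lemma NF_close {d K l m : ℕ} (hK : 0 < K) {P P' : Set (EuclideanSpace ℝ (Fin d))} {ρ : ℝ} (hρ : 0 < ρ)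
    (hb : P ⊆ closedBall 0 ρ)
    {T T' : Fin K → Fin l → Matrix (Fin m) (Fin m) ℝ} {p p' : Fin K → EuclideanSpace ℝ (Fin d)}
    (h : NF K l m P T p) (h' : NF K l m P' T' p') (η : ℝ) (hη : 0 ≤ η)
    (hT : ∀ i b j k, |T' i b j k - T i b j k| ≤ η)
    (hp : ∀ i j, |p' i j - p i j| ≤ ρ * η) :
    ∀ x ∈ P, ∃ y ∈ P', dist x y ≤ ρ * η * (K * d + 2 * K ^ 2 * m) := by
  have hK1 : (1:ℝ) ≤ K := by exact_mod_cast hK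
  have hK0 : (0:ℝ) < K := by linarith
  obtain ⟨h1, h2, h3, h4, V, hV, h5⟩ := h
  obtain ⟨h1', h2', h3', h4', V', hV', h5'⟩ := h'
  have hconvP : Convex ℝ P := by rw [hV]; exact convex_convexHull ℝ _
  have hconv : Convex ℝ P' := by rw [hV']; exact convex_convexHull ℝ _
  set r := ρ * η * (K * d + 2 * K ^ 2 * m) with hr
  have hnorm : ∀ x ∈ P, ‖x‖ ≤ ρ := fun x hx => by simpa using hb hx
  have key : ∀ v ∈ V, ∃ y ∈ P', dist v y ≤ r := by
    intro v hv
    have hvP : v ∈ P := by rw [hV]; exact subset_convexHull ℝ _ hv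
    obtain ⟨c, hc1, hc2, hc3, hc4⟩ := h5 v hv
    let t : ℝ := K * (m * η)
    have ht : 0 ≤ t := by positivity
    have hden : 0 < 1 + t * K := by positivity
    let μ : Fin K → ℝ := fun i => (c i + t) / (1 + t * K)
    have hμ1 : ∑ i, μ i = 1 := by
      simp only [μ, ← Finset.sum_div, Finset.sum_add_distrib, hc2]
      simp only [Finset.sum_const, Finset.card_univ, Fintype.card_fin, nsmul_eq_mul]
      rw [mul_comm t, div_self (by rw [mul_comm]; exact hden.ne')]
    have hμ2 : ∀ i, |μ i| ≤ 1 := by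
      intro i
      simp only [μ]
      rw [abs_div, abs_of_pos hden, div_le_one hden]
      have := abs_add_le (c i) t
      rw [abs_of_nonneg ht] at this
      have := hc1 i
      nlinarith
    refine ⟨∑ i, μ i • p' i, h4' μ hμ1 fun b => ?_, ?_⟩
    · have e1 : ∑ i, μ i • T' i b = (1 + t * K)⁻¹ • (∑ i, c i • T' i b + t • 1) := by
        rw [← h1' b, Finset.smul_sum, ← Finset.sum_add_distrib, Finset.smul_sum]
        refine Finset.sum_congr rfl fun i _ => ?_
        rw [← add_smul, smul_smul]
        congr 1
        simp only [μ]; field_simp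
      rw [e1]
      refine Matrix.PosSemidef.smul ?_ (by positivity)
      have hherm : (∑ i, c i • T' i b + t • (1 : Matrix (Fin m) (Fin m) ℝ)).IsHermitian := by
        refine Matrix.IsHermitian.add ?_ ?_
        · unfold Matrix.IsHermitian
          rw [Matrix.conjTranspose_sum]
          refine Finset.sum_congr rfl fun i _ => ?_
          rw [Matrix.conjTranspose_smul, (h2' i b).1]; simp
        · unfold Matrix.IsHermitian
          simp
      refine Matrix.PosSemidef.of_dotProduct_mulVec_nonneg hherm fun x => ?_
      have e2 : ∑ i, c i • T' i b + t • (1 : Matrix (Fin m) (Fin m) ℝ)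
          = ∑ i, c i • T i b + (∑ i, c i • (T' i b - T i b)) + t • 1 := by
        simp only [smul_sub, Finset.sum_sub_distrib]; abel
      have q1 := (hc3 b).dotProduct_mulVec_nonneg x
      have q2 := quad_bound (∑ i, c i • (T' i b - T i b)) (K * η) (fun j k => by
        rw [Matrix.sum_apply]
        refine (Finset.abs_sum_le_sum_abs _ _).trans ?_
        have : ∑ i : Fin K, η = K * η := by simp
        rw [← this]
        refine Finset.sum_le_sum fun i _ => ?_
        simp only [Matrix.smul_apply, Matrix.sub_apply, smul_eq_mul, abs_mul]
        have := hT i b j k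
        have := hc1 i
        nlinarith [abs_nonneg (c i), abs_nonneg (T' i b j k - T i b j k)]) x
      rw [e2, Matrix.add_mulVec, Matrix.add_mulVec, dotProduct_add, dotProduct_add,
        Matrix.smul_mulVec, Matrix.one_mulVec, dotProduct_smul]
      simp only [star_trivial, smul_eq_mul] at q1 ⊢
      have := (abs_le.1 q2).1
      have e3 : (m:ℝ) * (K * η) = t := by simp only [t]; ring
      rw [e3] at this
      linarith
    · -- distance
      let g : EuclideanSpace ℝ (Fin d) := ∑ i, ((K:ℝ)⁻¹) • p i
      have hg : g ∈ P := by
        refine hconvP.sum_mem (fun i _ => by positivity) ?_ (fun i _ => h3 i)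
        simp [hK0.ne']
      have e1 : v - ∑ i, μ i • p' i =
          (t * K / (1 + t * K)) • (v - g) - ∑ i, μ i • (p' i - p i) := by
        have e2 : ∑ i, μ i • p i = (1 + t * K)⁻¹ • v + (t * K / (1 + t * K)) • g := by
          rw [hc4]
          simp only [g, Finset.smul_sum, ← Finset.sum_add_distrib]
          refine Finset.sum_congr rfl fun i _ => ?_
          rw [smul_smul, smul_smul, ← add_smul]
          congr 1
          simp only [μ]; field_simp
        have e4 : v = (1 + t * K)⁻¹ • v + (t * K / (1 + t * K)) • v := by
          rw [← add_smul]
          have : (1 + t * K)⁻¹ + (t * K / (1 + t * K)) = 1 := by field_simp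
          rw [this, one_smul]
        simp only [smul_sub, Finset.sum_sub_distrib]
        rw [e2]
        nth_rewrite 1 [e4]
        abel
      rw [dist_eq_norm, e1]
      refine (norm_sub_le _ _).trans ?_
      have b1 : ‖(t * K / (1 + t * K)) • (v - g)‖ ≤ t * K * (2 * ρ) := by
        rw [norm_smul, Real.norm_eq_abs, abs_of_nonneg (by positivity)]
        refine mul_le_mul ?_ ?_ (norm_nonneg _) (by positivity)
        · exact div_le_self (by positivity) (by nlinarith)
        · have := norm_sub_le v g
          have := hnorm v hvP
          have := hnorm g hg
          linarith
      have b2 : ‖∑ i, μ i • (p' i - p i)‖ ≤ K * (d * (ρ * η)) := by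
        refine (norm_sum_le _ _).trans ?_
        have : ∑ i : Fin K, d * (ρ * η) = K * (d * (ρ * η)) := by simp
        rw [← this]
        refine Finset.sum_le_sum fun i _ => ?_
        rw [norm_smul, Real.norm_eq_abs]
        have b3 : ‖p' i - p i‖ ≤ d * (ρ * η) := by
          have : ‖p' i - p i‖ ≤ ∑ j, |(p' i - p i) j| := by
            rw [EuclideanSpace.norm_eq]
            refine Real.sqrt_le_iff.2 ⟨Finset.sum_nonneg fun _ _ => abs_nonneg _, ?_⟩
            simp only [Real.norm_eq_abs]
            exact Finset.sum_sq_le_sq_sum_of_nonneg (fun _ _ => abs_nonneg _)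
          refine this.trans ?_
          have : ∑ j : Fin d, (ρ * η) = d * (ρ * η) := by simp
          rw [← this]
          exact Finset.sum_le_sum fun j _ => by simpa using hp i j
        have := hμ2 i
        nlinarith [abs_nonneg (μ i), norm_nonneg (p' i - p i)]
      refine (add_le_add b1 b2).trans (le_of_eq ?_)
      simp only [hr, t]; ring
  -- extend from vertices to the polytope
  intro x hx
  have hsub : P ⊆ {x | ∃ y ∈ P', dist x y ≤ r} := by
    rw [hV]
    refine convexHull_min key ?_
    rintro x ⟨y, hy, hxy⟩ x' ⟨y', hy', hxy'⟩ a a' ha ha' haa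
    refine ⟨a • y + a' • y', hconv hy hy' ha ha' haa, ?_⟩
    rw [dist_eq_norm] at *
    have : a • x + a' • x' - (a • y + a' • y') = a • (x - y) + a' • (x' - y') := by
      simp only [smul_sub]; abel
    rw [this]
    refine (norm_add_le _ _).trans ?_
    rw [norm_smul, norm_smul, Real.norm_eq_abs, Real.norm_eq_abs, abs_of_nonneg ha, abs_of_nonneg ha']
    have : r = a * r + a' * r := by rw [← add_mul, haa, one_mul]
    rw [this]
    gcongr
  exact hsub hx

lemma pigeon {d K l m H : ℕ} (hK : 0 < K) (hH : 0 < H)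
    (F : Finset (Set (EuclideanSpace ℝ (Fin d)))) {ρ Δ : ℝ} (hρ : 0 < ρ)
    (hball : ∀ P ∈ F, P ⊆ Metric.closedBall 0 ρ)
    (hsep : ∀ P ∈ F, ∀ P' ∈ F, P ≠ P' → Δ ≤ Metric.hausdorffDist P P')
    (hNF : ∀ P ∈ F, ∃ T p, NF K l m P T p)
    (hΔ : ρ * (1 / H) * (K * d + 2 * K ^ 2 * m) < Δ) :
    F.card ≤ (2 * H + 1) ^ (K * (l * (m * m) + d)) := by
  classical
  by_contra hlt
  push Not at hlt
  have hH0 : (0:ℝ) < H := by exact_mod_cast hH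
  have hNF' : ∀ P : Set (EuclideanSpace ℝ (Fin d)), ∃ T p, P ∈ F → NF K l m P T p := by
    intro P
    by_cases h : P ∈ F
    · obtain ⟨T, p, h1⟩ := hNF P h
      exact ⟨T, p, fun _ => h1⟩
    · exact ⟨fun _ _ => 0, fun _ => 0, fun h' => absurd h' h⟩
  choose T p hTp using hNF'
  let f : Set (EuclideanSpace ℝ (Fin d)) → Fin K × ((Fin l × Fin m × Fin m) ⊕ Fin d) → ℝ :=
    fun P x => Sum.elim (fun y => T P x.1 y.1 y.2.1 y.2.2) (fun j => p P x.1 j / ρ) x.2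
  have hf : ∀ P ∈ F, ∀ x, |f P x| ≤ 1 := by
    rintro P hP ⟨i, y | j⟩
    · exact NF_entry (hTp P hP) _ _ _ _
    · have h1 : p P i ∈ P := (hTp P hP).2.2.1 i
      have h2 : ‖p P i‖ ≤ ρ := by simpa using hball P hP h1
      have h3 : |p P i j| ≤ ‖p P i‖ := by simpa using PiLp.norm_apply_le (p P i) j
      simp only [f, Sum.elim_inr]
      rw [abs_div, abs_of_pos hρ, div_le_one hρ]
      exact h3.trans h2
  let code : Set (EuclideanSpace ℝ (Fin d)) → Fin K × ((Fin l × Fin m × Fin m) ⊕ Fin d) → ℤ :=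
    fun P x => ⌊f P x * H⌋
  let S : Finset (Fin K × ((Fin l × Fin m × Fin m) ⊕ Fin d) → ℤ) :=
    Fintype.piFinset (fun _ => Finset.Icc (-(H:ℤ)) H)
  have hS : S.card = (2 * H + 1) ^ (K * (l * (m * m) + d)) := by
    simp only [S, Fintype.card_piFinset, Int.card_Icc, Finset.prod_const, Finset.card_univ,
      Fintype.card_prod, Fintype.card_sum, Fintype.card_fin]
    congr 1
    omega
  have hmap : ∀ P ∈ F, code P ∈ S := by
    intro P hP
    simp only [S, Fintype.mem_piFinset, Finset.mem_Icc, code]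
    intro x
    have := abs_le.1 (hf P hP x)
    constructor
    · rw [Int.le_floor]; push_cast; nlinarith
    · have : (⌊f P x * H⌋ : ℝ) ≤ H := (Int.floor_le _).trans (by nlinarith)
      exact_mod_cast this
  obtain ⟨P, hP, P', hP', hne, hcode⟩ :=
    Finset.exists_ne_map_eq_of_card_lt_of_maps_to (hS ▸ hlt) hmap
  have hclose : ∀ x, |f P' x - f P x| ≤ 1 / H := by
    intro x
    have h1 := Int.abs_sub_lt_one_of_floor_eq_floor (congrFun hcode x)
    rw [← sub_mul, abs_mul, abs_of_pos hH0] at h1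
    rw [abs_sub_comm, le_div_iff₀ hH0]
    exact h1.le
  have hcT : ∀ i b j k, |T P' i b j k - T P i b j k| ≤ 1 / H := fun i b j k =>
    hclose (i, Sum.inl (b, j, k))
  have hcp : ∀ i j, |p P' i j - p P i j| ≤ ρ * (1 / H) := by
    intro i j
    have h1 := hclose (i, Sum.inr j)
    simp only [f, Sum.elim_inr] at h1
    rw [← sub_div, abs_div, abs_of_pos hρ, div_le_iff₀ hρ] at h1
    linarith
  have hη : (0:ℝ) ≤ 1 / H := by positivity
  have c1 := NF_close hK hρ (hball P hP) (hTp P hP) (hTp P' hP') (1 / H) hη hcT hcp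
  have c2 := NF_close hK hρ (hball P' hP') (hTp P' hP') (hTp P hP) (1 / H) hη
    (fun i b j k => by rw [abs_sub_comm]; exact hcT i b j k)
    (fun i j => by rw [abs_sub_comm]; exact hcp i j)
  have h1 := hausdorffDist_le_of_mem_dist (by positivity) c1 c2
  have h2 := hsep P hP P' hP' hne
  linarith

lemma NF_one {d l m K : ℕ} (hK : K = 1) {P : Set (EuclideanSpace ℝ (Fin d))}
    {T : Fin K → Fin l → Matrix (Fin m) (Fin m) ℝ} {p : Fin K → EuclideanSpace ℝ (Fin d)}
    (h : NF K l m P T p) : ∃ y, P ⊆ {y} := by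
  subst hK
  obtain ⟨-, -, -, -, V, hV, h5⟩ := h
  refine ⟨p 0, ?_⟩
  rw [hV]
  refine convexHull_min (fun v hv => ?_) (convex_singleton _)
  obtain ⟨c, -, hc, -, hv'⟩ := h5 v hv
  simp at hc hv'
  rw [hv', hc, one_smul]
  rfl

theorem statement0 (d l m : ℕ) (F : Finset (Set (EuclideanSpace ℝ (Fin d))))
    (hcard : 2 ≤ F.card)
    (hpoly : ∀ P ∈ F, IsPolytope P)
    (hdim : ∀ P ∈ F, 1 ≤ Module.finrank ℝ (affineSpan ℝ P).direction)
    (hext : ∀ P ∈ F, HasSdpExtBlocks P l m)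
    (ρ Δ : ℝ) (hρ : 0 < ρ) (hΔ : 0 < Δ)
    (hball : ∀ P ∈ F, P ⊆ Metric.closedBall 0 ρ)
    (hsep : ∀ P ∈ F, ∀ P' ∈ F, P ≠ P' → Δ ≤ Metric.hausdorffDist P P') :
    Real.logb 2 F.card /
        (8 * d * (1 + Real.logb 2 (2 * ρ / Δ) + Real.logb 2 (Real.logb 2 F.card)))
      ≤ (l : ℝ) ^ 2 * (m : ℝ) ^ 4 := by
  classical
  have hne : ∀ P ∈ F, P.Nonempty := by
    intro P hP
    by_contra h
    rw [Set.not_nonempty_iff_eq_empty] at h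
    have h1 := hdim P hP
    rw [h, AffineSubspace.span_empty, AffineSubspace.direction_bot] at h1
    simp at h1
  have hNF : ∀ P ∈ F, ∃ T p, NF (l * (m * m) + 1) l m P T p := fun P hP =>
    exists_NF P (hpoly P hP) (hne P hP) (hext P hP)
  obtain ⟨P, hP, P', hP', hPP⟩ := Finset.one_lt_card.1 (show 1 < F.card by omega)
  have hR1 : 1 ≤ 2 * ρ / Δ := by
    rw [le_div_iff₀ hΔ, one_mul]
    refine (hsep P hP P' hP' hPP).trans ?_
    have hd : ∀ x ∈ closedBall (0 : EuclideanSpace ℝ (Fin d)) ρ,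
        ∀ y ∈ closedBall (0 : EuclideanSpace ℝ (Fin d)) ρ, dist x y ≤ 2 * ρ := by
      intro x hx y hy
      have := dist_triangle_right x y 0
      rw [mem_closedBall] at hx hy
      linarith
    refine hausdorffDist_le_of_mem_dist (by positivity) (fun x hx => ?_) (fun x hx => ?_)
    · obtain ⟨y, hy⟩ := hne P' hP'
      exact ⟨y, hy, hd x (hball P hP hx) y (hball P' hP' hy)⟩
    · obtain ⟨y, hy⟩ := hne P hP
      exact ⟨y, hy, hd x (hball P' hP' hx) y (hball P hP hy)⟩
  have hd1 : 1 ≤ d := by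
    have h1 := hdim P hP
    have h2 := Submodule.finrank_le (affineSpan ℝ P).direction
    rw [finrank_euclideanSpace_fin] at h2
    omega
  have hN1 : 1 ≤ l * (m * m) := by
    by_contra h0
    have h0 : l * (m * m) = 0 := by omega
    obtain ⟨T, p, h⟩ := hNF P hP
    obtain ⟨y, hy⟩ := NF_one (by omega) h
    have h1 := hdim P hP
    have h2 : P = {y} := (Set.Nonempty.subset_singleton_iff (hne P hP)).1 hy
    rw [h2, direction_affineSpan, vectorSpan_singleton] at h1
    simp at h1
  set N := l * (m * m) with hN
  set Λ := Real.logb 2 F.card with hΛ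
  set R := 2 * ρ / Δ with hR
  have hcard' : (2:ℝ) ≤ F.card := by exact_mod_cast hcard
  have hΛ1 : 1 ≤ Λ := by
    rw [hΛ, Real.le_logb_iff_rpow_le (by norm_num) (by linarith)]
    simpa using hcard'
  set L := 1 + Real.logb 2 R + Real.logb 2 Λ with hL
  have hL1 : 1 ≤ L := by
    have := Real.logb_nonneg (b := 2) (by norm_num) hR1
    have := Real.logb_nonneg (b := 2) (by norm_num) hΛ1
    linarith
  have hdR : (1:ℝ) ≤ d := by exact_mod_cast hd1
  have hNR : (1:ℝ) ≤ N := by exact_mod_cast hN1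
  have hden : 0 < 8 * d * L := by positivity
  have hRHS : (l:ℝ) ^ 2 * (m:ℝ) ^ 4 = (N:ℝ) ^ 2 := by
    rw [hN]; push_cast; ring
  rw [hRHS, div_le_iff₀ hden]
  by_contra hcon
  push Not at hcon
  have hmN : (m:ℝ) ≤ N := by
    have : m ≤ N := by
      rcases Nat.eq_zero_or_pos l with h | h
      · simp [hN, h] at hN1
      · rw [hN]; nlinarith [Nat.le_mul_self m]
    exact_mod_cast this
  have h2L : (2:ℝ) ^ L = 2 * R * Λ := by
    rw [hL, Real.rpow_add (by norm_num), Real.rpow_add (by norm_num), Real.rpow_one,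
      Real.rpow_logb (by norm_num) (by norm_num) (by linarith),
      Real.rpow_logb (by norm_num) (by norm_num) (by linarith)]
  have hdN : (1:ℝ) ≤ d * N ^ 3 := by
    have : (1:ℝ) ≤ (N:ℝ) ^ 3 := one_le_pow₀ hNR
    exact one_le_mul_of_one_le_of_one_le hdR this
  have hΛbig : 8 * d * N ^ 2 ≤ Λ := by
    have : (0:ℝ) ≤ 8 * d * N ^ 2 := by positivity
    have h3 := le_mul_of_one_le_right this hL1
    have h4 : 8 * d * N ^ 2 * L = (N:ℝ) ^ 2 * (8 * d * L) := by ring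
    linarith
  let H : ℕ := ⌊5 * R * d * (N:ℝ) ^ 3⌋₊ + 1
  have hHgt : 5 * R * d * (N:ℝ) ^ 3 < H := by
    simp only [H]; push_cast; exact Nat.lt_floor_add_one _
  have hHle : (H:ℝ) ≤ 5 * R * d * (N:ℝ) ^ 3 + 1 := by
    simp only [H]; push_cast
    have := Nat.floor_le (show 0 ≤ 5 * R * d * (N:ℝ) ^ 3 by positivity)
    linarith
  have hH0 : (0:ℝ) < H := by simp only [H]; positivity
  have hX : ((N + 1 : ℕ) : ℝ) * d + 2 * ((N + 1 : ℕ) : ℝ) ^ 2 * m ≤ 10 * (d * N ^ 3) := by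
    push_cast
    have hK : (N:ℝ) + 1 ≤ 2 * N := by linarith
    have a1 : ((N:ℝ) + 1) * d ≤ 2 * (d * N ^ 3) := by
      have : (N:ℝ) ≤ N ^ 3 := le_self_pow₀ hNR (by norm_num)
      calc ((N:ℝ) + 1) * d ≤ (2 * N ^ 3) * d := by gcongr; linarith
        _ = _ := by ring
    have a2 : 2 * ((N:ℝ) + 1) ^ 2 * m ≤ 2 * (2 * N) ^ 2 * N := by gcongr
    have a3 : (N:ℝ) ^ 3 ≤ d * N ^ 3 := le_mul_of_one_le_left (by positivity) hdR
    have a4 : 2 * (2 * (N:ℝ)) ^ 2 * N = 8 * N ^ 3 := by ring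
    linarith
  have hclose : ρ * (1 / H) * (((N + 1 : ℕ) : ℝ) * d + 2 * ((N + 1 : ℕ) : ℝ) ^ 2 * m) < Δ := by
    have hΔR : Δ * R = 2 * ρ := by rw [hR]; field_simp
    calc ρ * (1 / H) * (((N + 1 : ℕ) : ℝ) * d + 2 * ((N + 1 : ℕ) : ℝ) ^ 2 * m)
        ≤ ρ * (1 / H) * (10 * (d * N ^ 3)) := by gcongr
      _ = (ρ * (10 * (d * N ^ 3))) / H := by ring
      _ < Δ := by
        rw [div_lt_iff₀ hH0]
        have := mul_lt_mul_of_pos_left hHgt hΔ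
        have e : Δ * (5 * R * d * (N:ℝ) ^ 3) = ρ * (10 * (d * N ^ 3)) := by
          calc Δ * (5 * R * d * (N:ℝ) ^ 3) = (Δ * R) * (5 * d * (N:ℝ) ^ 3) := by ring
            _ = _ := by rw [hΔR]; ring
        linarith
  have hpig := pigeon (Nat.succ_pos N) (show 0 < H by simp [H]) F hρ hball hsep hNF hclose
  have hG : (2 * H + 1 : ℝ) ≤ (2:ℝ) ^ (2 * L) := by
    have e : (2:ℝ) ^ (2 * L) = (2 * R * Λ) ^ 2 := by
      rw [mul_comm 2 L, Real.rpow_mul (by norm_num), h2L]; norm_num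
    rw [e]
    have a0 : 1 ≤ R * (d * N ^ 3) := one_le_mul_of_one_le_of_one_le hR1 hdN
    have a1 : (2 * H + 1 : ℝ) ≤ 13 * (R * (d * N ^ 3)) := by linarith
    have a2 : (8 * d * (N:ℝ) ^ 2) ^ 2 ≤ Λ ^ 2 := by gcongr
    have a3 : R ≤ R ^ 2 := le_self_pow₀ hR1 (by norm_num)
    have a4 : (d:ℝ) * N ^ 3 ≤ d ^ 2 * N ^ 4 := by
      have : (d:ℝ) ≤ d ^ 2 := le_self_pow₀ hdR (by norm_num)
      have : (N:ℝ) ^ 3 ≤ N ^ 4 := pow_le_pow_right₀ hNR (by norm_num)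
      gcongr
    calc (2 * H + 1 : ℝ) ≤ 13 * (R * (d * N ^ 3)) := a1
      _ ≤ 13 * (R ^ 2 * (d ^ 2 * N ^ 4)) := by gcongr
      _ ≤ 4 * (R ^ 2 * (8 * d * (N:ℝ) ^ 2) ^ 2) := by
        have : 0 ≤ R ^ 2 * ((d:ℝ) ^ 2 * N ^ 4) := by positivity
        have e2 : 4 * (R ^ 2 * (8 * d * (N:ℝ) ^ 2) ^ 2) = 256 * (R ^ 2 * ((d:ℝ) ^ 2 * N ^ 4)) := by
          ring
        linarith
      _ ≤ 4 * (R ^ 2 * Λ ^ 2) := by gcongr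
      _ = (2 * R * Λ) ^ 2 := by ring
  have hexp : (((N + 1) * (N + d) : ℕ) : ℝ) ≤ 4 * d * N ^ 2 := by
    push_cast
    have b1 : (N:ℝ) + 1 ≤ 2 * N := by linarith
    have b2 : (N:ℝ) + d ≤ 2 * (d * N) := by
      have c1 : (N:ℝ) ≤ d * N := le_mul_of_one_le_left (by positivity) hdR
      have c2 : (d:ℝ) ≤ d * N := le_mul_of_one_le_right (by positivity) hNR
      linarith
    calc ((N:ℝ) + 1) * (N + d) ≤ (2 * N) * (2 * (d * N)) := by gcongr
      _ = _ := by ring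
  have hfin : (F.card : ℝ) ≤ (2:ℝ) ^ (8 * d * N ^ 2 * L) := by
    calc (F.card : ℝ) ≤ (2 * H + 1 : ℝ) ^ ((N + 1) * (N + d)) := by exact_mod_cast hpig
      _ ≤ ((2:ℝ) ^ (2 * L)) ^ ((N + 1) * (N + d)) := by gcongr
      _ = (2:ℝ) ^ (2 * L * (((N + 1) * (N + d) : ℕ) : ℝ)) := by
        exact (by rw [Real.rpow_mul (by norm_num : (0:ℝ) ≤ 2) (2 * L), Real.rpow_natCast])
      _ ≤ (2:ℝ) ^ (8 * d * N ^ 2 * L) := by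
        refine Real.rpow_le_rpow_of_exponent_le (by norm_num) ?_
        calc 2 * L * (((N + 1) * (N + d) : ℕ) : ℝ) ≤ 2 * L * (4 * d * N ^ 2) := by gcongr
          _ = 8 * d * N ^ 2 * L := by ring
  have hlast : Λ ≤ 8 * d * N ^ 2 * L := by
    rw [hΛ, Real.logb_le_iff_le_rpow (by norm_num) (by linarith)]
    exact hfin
  have hring : 8 * d * N ^ 2 * L = (N:ℝ) ^ 2 * (8 * d * L) := by ring
  linarith
end
end

section
/- Let P ⊆ ℝ^d be a polytope with dim(P) ≥ 1. If P has an extended formulation with ℓ LMIs of size m, then P also has a normalized extended formulation with ℓ LMIs of size m; that is, there exist n ∈ ℕ, an affine map φ : ℝ^n → ℝ^d and affine maps M₁,…,M_ℓ : ℝ^n → Sym_m(ℝ) with M₁(0) = ⋯ = M_ℓ(0) = I such that, setting Q = {x ∈ ℝ^n : M_i(x) is positive semidefinite for all i ∈ [ℓ]}, one has P = φ(Q) and B^n ⊆ Q ⊆ n·B^n. -/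
open Metric Set

noncomputable section

section AuxMatrix

open scoped Matrix


lemma aux_diag {m : ℕ} (A : Matrix (Fin m) (Fin m) ℝ) (hA : A.PosSemidef) :
    ∃ (C : Matrix (Fin m) (Fin m) ℝ) (e : Fin m → ℝ), IsUnit C ∧ (∀ j, e j = 0 ∨ e j = 1) ∧
      star C * A * C = 1 - Matrix.diagonal e := by
  classical
  have hH := hA.isHermitian
  let U : Matrix (Fin m) (Fin m) ℝ := hH.eigenvectorUnitary
  let μ := hH.eigenvalues
  have hμ : ∀ j, 0 ≤ μ j := hA.eigenvalues_nonneg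
  have hU : star U * A * U = Matrix.diagonal μ := by
    have := hH.conjStarAlgAut_star_eigenvectorUnitary
    rw [Unitary.conjStarAlgAut_star_apply] at this
    simpa [U, μ, Function.comp_def] using this
  let s : Fin m → ℝ := fun j => if μ j = 0 then 1 else (Real.sqrt (μ j))⁻¹
  have hs : ∀ j, s j ≠ 0 := by
    intro j
    by_cases h : μ j = 0
    · simp [s, h]
    · have : 0 < μ j := lt_of_le_of_ne (hμ j) (Ne.symm h)
      simp only [s, h, if_false]
      have := Real.sqrt_pos.2 this
      positivity
  refine ⟨U * Matrix.diagonal s, fun j => if μ j = 0 then 1 else 0, ?_, ?_, ?_⟩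
  · refine IsUnit.mul ?_ ?_
    · exact (Unitary.toUnits hH.eigenvectorUnitary).isUnit
    · rw [Matrix.isUnit_diagonal]
      exact Pi.isUnit_iff.2 fun j => (hs j).isUnit
  · intro j
    by_cases h : μ j = 0 <;> simp [h]
  · have : star (U * Matrix.diagonal s) * A * (U * Matrix.diagonal s)
        = Matrix.diagonal s * (star U * A * U) * Matrix.diagonal s := by
      rw [star_mul]
      have : star (Matrix.diagonal s) = Matrix.diagonal s := by
        rw [Matrix.star_eq_conjTranspose, Matrix.diagonal_conjTranspose]; simp
      rw [this]
      simp only [mul_assoc]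
    rw [this, hU, Matrix.diagonal_mul_diagonal, Matrix.diagonal_mul_diagonal, ← Matrix.diagonal_one,
      Matrix.diagonal_sub]
    congr 1
    funext j
    by_cases h : μ j = 0
    · simp [s, h]
    · have : 0 < μ j := lt_of_le_of_ne (hμ j) (Ne.symm h)
      have h2 := Real.sqrt_pos.2 this
      simp only [s, h, if_false]
      field_simp
      rw [Real.sq_sqrt (hμ j)]; ring

lemma aux_normalize {m : ℕ} {E : Type*} [NormedAddCommGroup E] [NormedSpace ℝ E]
    (M : E →ᵃ[ℝ] Matrix (Fin m) (Fin m) ℝ) (hM : ∀ x, (M x).IsSymm)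
    (hB : ∀ x ∈ closedBall (0 : E) 1, (M x).PosSemidef) :
    ∃ M' : E →ᵃ[ℝ] Matrix (Fin m) (Fin m) ℝ, (∀ x, (M' x).IsSymm) ∧ M' 0 = 1 ∧
      ∀ x, (M' x).PosSemidef ↔ (M x).PosSemidef := by
  classical
  obtain ⟨C, e, hC, he, hCe⟩ := aux_diag (M 0) (hB 0 (by simp))
  let N : E →ᵃ[ℝ] Matrix (Fin m) (Fin m) ℝ :=
    (LinearMap.mulLeft ℝ (star C) ∘ₗ LinearMap.mulRight ℝ C).toAffineMap.comp M
  have hN : ∀ x, N x = star C * M x * C := by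
    intro x; simp [N, mul_assoc]
  have hNP : ∀ x, (N x).PosSemidef ↔ (M x).PosSemidef := by
    intro x
    rw [hN]; exact Matrix.IsUnit.posSemidef_star_left_conjugate_iff hC
  have hN0 : N 0 = 1 - Matrix.diagonal e := by rw [hN, hCe]
  have hNs : ∀ x, (N x).IsSymm := by
    intro x
    rw [hN, Matrix.IsSymm, Matrix.star_eq_conjTranspose, Matrix.conjTranspose_eq_transpose_of_trivial,
      Matrix.transpose_mul, Matrix.transpose_mul, (hM x).eq]
    simp [mul_assoc]
  -- columns
  have hdec : ∀ x, N x = N.linear x + N 0 := fun x => by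
    have := N.decomp' ; simpa using congrFun N.decomp x
  have hcol1 : ∀ j, e j = 1 → ∀ x ∈ closedBall (0 : E) 1, N x *ᵥ Pi.single j 1 = 0 := by
    intro j hj x hx
    have h1 := (hNP x).2 (hB x hx)
    have h2 := (hNP (-x)).2 (hB (-x) (by simpa using hx))
    have d1 := h1.diag_nonneg (i := j)
    have d2 := h2.diag_nonneg (i := j)
    have hsum : N x j j + N (-x) j j = 0 := by
      rw [hdec x, hdec (-x), hN0]
      simp [hj]
    have hz : N x j j = 0 := by linarith
    rw [← h1.dotProduct_mulVec_zero_iff]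
    simp [hz]
  have hcol0 : ∀ j, e j = 1 → N 0 *ᵥ Pi.single j 1 = 0 := fun j hj => hcol1 j hj 0 (by simp)
  have hcol : ∀ j, e j = 1 → ∀ x, N x *ᵥ Pi.single j 1 = 0 := by
    intro j hj x
    by_cases hx : x = 0
    · rw [hx]; exact hcol0 j hj
    have hn : ‖x‖ ≠ 0 := by simpa using hx
    have h := hcol1 j hj (‖x‖⁻¹ • x) (by simp [norm_smul, hn])
    rw [hdec, Matrix.add_mulVec, hcol0 j hj, add_zero, map_smul, Matrix.smul_mulVec] at h
    have h' := (smul_eq_zero.1 h).resolve_left (inv_ne_zero hn)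
    rw [hdec, Matrix.add_mulVec, hcol0 j hj, h', add_zero]
  have hNE : ∀ x, N x * Matrix.diagonal e = 0 := by
    intro x
    ext i j
    rw [Matrix.mul_diagonal]
    rcases he j with h | h
    · simp [h]
    · have := congrFun (hcol j h x) i
      simp at this
      simp [this]
  have hEN : ∀ x, Matrix.diagonal e * N x = 0 := by
    intro x
    have := congrArg Matrix.transpose (hNE x)
    rw [Matrix.transpose_mul, (hNs x).eq, Matrix.diagonal_transpose] at this
    simpa using this
  have hEE : Matrix.diagonal e * Matrix.diagonal e = Matrix.diagonal e := by
    rw [Matrix.diagonal_mul_diagonal]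
    congr 1; funext j
    rcases he j with h | h <;> simp [h]
  have hEp : (Matrix.diagonal e).PosSemidef := by
    apply Matrix.PosSemidef.diagonal
    intro j
    rcases he j with h | h <;> simp [h]
  refine ⟨N + AffineMap.const ℝ E (Matrix.diagonal e), ?_, ?_, ?_⟩
  · intro x
    have : (N + AffineMap.const ℝ E (Matrix.diagonal e)) x = N x + Matrix.diagonal e := rfl
    rw [this]
    exact (hNs x).add (Matrix.isSymm_diagonal e)
  · have : (N + AffineMap.const ℝ E (Matrix.diagonal e)) 0 = N 0 + Matrix.diagonal e := rfl
    rw [this, hN0]; simp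
  · intro x
    have : (N + AffineMap.const ℝ E (Matrix.diagonal e)) x = N x + Matrix.diagonal e := rfl
    rw [this, ← hNP]
    constructor
    · intro h
      have h2 := h.conjTranspose_mul_mul_same (1 - Matrix.diagonal e)
      have h3 : (1 - Matrix.diagonal e).conjTranspose = 1 - Matrix.diagonal e := by
        simp
      rw [h3] at h2
      convert h2 using 1
      have a1 := hNE x
      have a2 := hEN x
      simp only [mul_add, sub_mul, mul_sub, add_mul, one_mul, mul_one, a1, a2, hEE]
      simp
    · intro h; exact h.add hEp

lemma aux_closed {m n l : ℕ} 
    (M : Fin l → (EuclideanSpace ℝ (Fin n) →ᵃ[ℝ] Matrix (Fin m) (Fin m) ℝ)) (hM : ∀ i x, (M i x).IsSymm) :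
    IsClosed {x | ∀ i, (M i x).PosSemidef} ∧ Convex ℝ {x | ∀ i, (M i x).PosSemidef} := by
  have hEq : {x | ∀ i, (M i x).PosSemidef} = 
      ⋂ i, ⋂ v : Fin m → ℝ, {x | 0 ≤ v ⬝ᵥ (M i x *ᵥ v)} := by
    ext x
    simp only [mem_ofPred_eq, mem_iInter]
    refine forall_congr' fun i => ?_
    rw [Matrix.posSemidef_iff_dotProduct_mulVec]
    have : (M i x).IsHermitian := by
      rw [Matrix.IsHermitian, Matrix.conjTranspose_eq_transpose_of_trivial]; exact hM i x
    simp only [this, true_and, star_trivial]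
  constructor
  · rw [hEq]
    refine isClosed_iInter fun i => isClosed_iInter fun v => ?_
    have : Continuous (M i) := by
      rw [AffineMap.decomp (M i)]
      exact (LinearMap.continuous_of_finiteDimensional (M i).linear).add continuous_const
    exact isClosed_le continuous_const (by fun_prop)
  · intro x hx y hy a b ha hb hab i
    rw [Convex.combo_affine_apply hab]
    exact ((hx i).smul ha).add ((hy i).smul hb)

end AuxMatrix


/-- Real-number estimate behind John's theorem. -/
lemma aux_param (n : ℕ) (hn : 1 ≤ n) (R : ℝ) (hR : (n : ℝ) < R) :
    ∃ β : ℝ, 0 < β ∧ β < 1 ∧ 1 < (1 + β * (R - 1) / 2) ^ 2 * (1 - β) ^ (n - 1) := by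
  have hn' : (1 : ℝ) ≤ n := by exact_mod_cast hn
  have hRpos : 0 < R := by linarith
  have hβ0 : 0 < (R - n) / R ^ 2 := div_pos (by linarith) (by positivity)
  have hkey : (R - n) / R ^ 2 * R ^ 2 = R - n := by field_simp
  refine ⟨(R - n) / R ^ 2, hβ0, ?_, ?_⟩
  · rw [div_lt_one (by positivity)]; nlinarith
  · set β := (R - n) / R ^ 2 with hβ
    have hβ1 : β < 1 := by
      rw [hβ, div_lt_one (by positivity)]; nlinarith
    have hbern := one_add_mul_le_pow (a := -β) (by linarith) (n - 1)
    have hcast : ((n - 1 : ℕ) : ℝ) = n - 1 := by push_cast [Nat.cast_sub hn]; ring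
    rw [hcast] at hbern
    have hpow : 0 ≤ (1 - β) ^ (n - 1) := pow_nonneg (by linarith) _
    have h1 : 1 + β * (R - 1) ≤ (1 + β * (R - 1) / 2) ^ 2 := by
      nlinarith [sq_nonneg (β * (R - 1) / 2)]
    have h2 : 1 - (n - 1) * β ≤ (1 - β) ^ (n - 1) := by
      have : 1 + -β = 1 - β := by ring
      rw [this] at hbern
      linarith
    have h0 : 0 ≤ 1 + β * (R - 1) := by
      have : 0 ≤ β * (R - 1) := mul_nonneg hβ0.le (by linarith)
      linarith
    have h3 : (R - 1) * (n - 1) < R ^ 2 := by nlinarith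
    have h4 : β * ((R - 1) * (n - 1)) < R - n := by
      rw [← hkey]; exact mul_lt_mul_of_pos_left h3 hβ0
    have h5 : 1 < (1 + β * (R - 1)) * (1 - (n - 1) * β) := by
      have : (1 + β * (R - 1)) * (1 - (n - 1) * β)
        = 1 + β * ((R - n) - β * ((R - 1) * (n - 1))) := by ring
      rw [this]
      have := mul_pos hβ0 (sub_pos.2 h4)
      linarith
    calc 1 < (1 + β * (R - 1)) * (1 - (n - 1) * β) := h5
      _ ≤ (1 + β * (R - 1)) * (1 - β) ^ (n - 1) := mul_le_mul_of_nonneg_left h2 h0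
      _ ≤ _ := mul_le_mul_of_nonneg_right h1 hpow

/-- If a closed convex set contains the unit ball and a point of norm `> n`, it contains an ellipsoid
of larger volume. -/
lemma aux_bigger (n : ℕ) (hn : 1 ≤ n) (K : Set (EuclideanSpace ℝ (Fin n)))
    (hK : IsClosed K) (hKc : Convex ℝ K) (hB : closedBall 0 1 ⊆ K) (y : EuclideanSpace ℝ (Fin n))
    (hy : y ∈ K) (hyn : (n : ℝ) < ‖y‖) :
    ∃ (A : EuclideanSpace ℝ (Fin n) →L[ℝ] EuclideanSpace ℝ (Fin n)) (c : EuclideanSpace ℝ (Fin n)),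
      (∀ z ∈ closedBall 0 1, A z + c ∈ K) ∧ 1 < |A.det| := by
  obtain ⟨β, hβ0, hβ1, hβ⟩ := aux_param n hn ‖y‖ hyn
  have hn' : (1 : ℝ) ≤ n := by exact_mod_cast hn
  set R := ‖y‖ with hR
  have hRpos : 0 < R := by linarith
  set c := β * (R - 1) / 2 with hc
  have hc0 : 0 < c := by
    have := mul_pos hβ0 (show 0 < R - 1 by linarith); linarith
  set b := Real.sqrt (1 - β) with hb
  have hb0 : 0 < b := Real.sqrt_pos.2 (by linarith)
  have hb2 : b ^ 2 = 1 - β := Real.sq_sqrt (by linarith)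
  set u : EuclideanSpace ℝ (Fin n) := R⁻¹ • y with hu
  have hun : ‖u‖ = 1 := by
    rw [hu, norm_smul, norm_inv, Real.norm_of_nonneg hRpos.le, ← hR]; field_simp
  have hyu : y = R • u := by rw [hu, smul_smul, mul_inv_cancel₀ hRpos.ne', one_smul]
  have huu : inner ℝ u u = (1 : ℝ) := by rw [real_inner_self_eq_norm_sq, hun]; norm_num
  let A0 : EuclideanSpace ℝ (Fin n) →ₗ[ℝ] EuclideanSpace ℝ (Fin n) :=
    b • LinearMap.transvection (innerSL ℝ u).toLinearMap (((1 + c) / b - 1) • u)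
  have hA0 : ∀ z, A0 z = b • z + ((1 + c - b) * inner ℝ u z) • u := by
    intro z
    simp only [A0, LinearMap.smul_apply, LinearMap.transvection.apply, smul_add, smul_smul]
    congr 2
    simp
    field_simp
  refine ⟨LinearMap.toContinuousLinearMap A0, c • u, ?_, ?_⟩
  · intro z hz
    have hz1 : ‖z‖ ≤ 1 := by simpa using hz
    simp only [LinearMap.coe_toContinuousLinearMap']
    by_contra hcon
    obtain ⟨f, h, hf, hfx⟩ := geometric_hahn_banach_closed_point hKc hK hcon
    obtain ⟨w, rfl⟩ := (InnerProductSpace.toDual ℝ (EuclideanSpace ℝ (Fin n))).surjective f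
    simp only [InnerProductSpace.toDual_apply_apply] at hf hfx
    have hh0 : 0 < h := by simpa using hf 0 (hB (by simp))
    set s : ℝ := inner ℝ w u with hs
    have hwh : ‖w‖ ≤ h := by
      by_cases hw : w = 0
      · simp [hw, hh0.le]
      have hwn : ‖w‖ ≠ 0 := by simpa using hw
      have := hf (‖w‖⁻¹ • w) (hB (by simp [norm_smul, hwn]))
      rw [inner_smul_right, real_inner_self_eq_norm_sq] at this
      have e : ‖w‖⁻¹ * ‖w‖ ^ 2 = ‖w‖ := by field_simp
      rw [e] at this
      exact this.le
    have hsw : |s| ≤ ‖w‖ := by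
      have := abs_real_inner_le_norm w u
      rwa [hun, mul_one] at this
    have hRs : R * s ≤ h := by
      have := hf y hy
      rw [hyu, inner_smul_right] at this
      exact this.le
    have hs1 : -h ≤ s := by linarith [neg_abs_le s]
    -- the value of the functional
    have hval : inner ℝ w (A0 z + c • u) = inner ℝ (A0 w) z + c * s := by
      rw [hA0, hA0]
      simp only [inner_add_right, inner_add_left, inner_smul_right, inner_smul_left, ← hs]
      rw [real_inner_comm w u]
      simp
      ring
    have hnorm : ‖A0 w‖ ^ 2 = b ^ 2 * ‖w‖ ^ 2 + ((1 + c) ^ 2 - b ^ 2) * s ^ 2 := by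
      rw [← real_inner_self_eq_norm_sq, ← real_inner_self_eq_norm_sq, hA0, real_inner_comm w u, ← hs]
      simp only [inner_add_right, inner_add_left, inner_smul_right, inner_smul_left, huu,
        real_inner_comm w u, ← hs]
      simp
      ring
    have hle : inner ℝ (A0 w) z ≤ ‖A0 w‖ := by
      calc _ ≤ ‖A0 w‖ * ‖z‖ := real_inner_le_norm _ _
        _ ≤ ‖A0 w‖ * 1 := mul_le_mul_of_nonneg_left hz1 (norm_nonneg _)
        _ = _ := mul_one _
    have hcs : 0 ≤ h - c * s := by
      have h1 : R * (c * s) ≤ c * h := by nlinarith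
      have h2 : c * h ≤ R * h := by
        apply mul_le_mul_of_nonneg_right _ hh0.le
        rw [hc]; nlinarith
      have h3 : R * (c * s) ≤ R * h := h1.trans h2
      linarith [le_of_mul_le_mul_left h3 hRpos]
    have hfin : ‖A0 w‖ ≤ h - c * s := by
      refine (sq_le_sq₀ (norm_nonneg _) hcs).1 ?_
      rw [hnorm]
      have hw2 : ‖w‖ ^ 2 ≤ h ^ 2 := by gcongr
      have h1 : b ^ 2 * ‖w‖ ^ 2 ≤ b ^ 2 * h ^ 2 := by gcongr
      have h2 : 0 ≤ β * ((s + h) * (h - R * s)) :=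
        mul_nonneg hβ0.le (mul_nonneg (by linarith) (by linarith))
      have h3 : (h - c * s) ^ 2 - (b ^ 2 * h ^ 2 + ((1 + c) ^ 2 - b ^ 2) * s ^ 2)
          = β * ((s + h) * (h - R * s)) := by
        rw [hb2, hc]; ring
      linarith
    rw [hval] at hfx
    linarith
  · have hdet : (LinearMap.toContinuousLinearMap A0).det = b ^ (n - 1) * (1 + c) := by
      change LinearMap.det A0 = _
      simp only [A0, LinearMap.det_smul, LinearMap.transvection.det]
      rw [finrank_euclideanSpace_fin]
      obtain ⟨k, rfl⟩ : ∃ k, n = k + 1 := ⟨n - 1, by omega⟩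
      simp [hun]
      field_simp
      ring
    rw [hdet, ← one_lt_sq_iff_one_lt_abs, mul_pow, ← pow_mul, mul_comm (n-1) 2, pow_mul, hb2]
    linarith

lemma aux_john (n : ℕ) (K : Set (EuclideanSpace ℝ (Fin n)))
    (hK : IsClosed K) (hKc : Convex ℝ K) (hKb : Bornology.IsBounded K) (hKi : (interior K).Nonempty) :
    ∃ (A : EuclideanSpace ℝ (Fin n) →L[ℝ] EuclideanSpace ℝ (Fin n)) (c : EuclideanSpace ℝ (Fin n)),
      Function.Surjective A ∧ closedBall 0 1 ⊆ {x | A x + c ∈ K} ∧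
      {x | A x + c ∈ K} ⊆ closedBall 0 n := by
  let E := EuclideanSpace ℝ (Fin n)
  let S : Set ((E →L[ℝ] E) × E) := {p | ∀ z ∈ closedBall (0 : E) 1, p.1 z + p.2 ∈ K}
  have hSc : IsClosed S := by
    have : S = ⋂ z ∈ closedBall (0 : E) 1, {p : (E →L[ℝ] E) × E | p.1 z + p.2 ∈ K} := by
      ext p; simp [S]
    rw [this]
    refine isClosed_biInter fun z _ => hK.preimage (by fun_prop)
  obtain ⟨r, hr⟩ := hKb.subset_closedBall 0
  have hSb : Bornology.IsBounded S := by
    refine (isBounded_iff_subset_closedBall 0).2 ⟨2 * max r 0, ?_⟩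
    rintro ⟨A, c⟩ hp
    have hcr : ‖c‖ ≤ r := by
      have := hr (hp 0 (by simp)); simpa using this
    have hr0 : 0 ≤ r := (norm_nonneg _).trans hcr
    have hA : ‖A‖ ≤ 2 * r := by
      refine ContinuousLinearMap.opNorm_le_of_unit_norm (by linarith) fun z hz => ?_
      have h1 : ‖A z + c‖ ≤ r := by
        have := hr (hp z (by simp [hz])); simpa using this
      calc ‖A z‖ = ‖(A z + c) - c‖ := by simp
        _ ≤ ‖A z + c‖ + ‖c‖ := norm_sub_le _ _
        _ ≤ 2 * r := by linarith
    rw [mem_closedBall_zero_iff, Prod.norm_def, max_eq_left hr0]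
    exact max_le hA (by simp only; linarith)
  have hScomp : IsCompact S := isCompact_of_isClosed_isBounded hSc hSb
  obtain ⟨x0, hx0⟩ := hKi
  obtain ⟨ε, hε, hεK⟩ := nhds_basis_closedBall.mem_iff.1 (mem_interior_iff_mem_nhds.1 hx0)
  have hmem : ((ε • ContinuousLinearMap.id ℝ E, x0) : (E →L[ℝ] E) × E) ∈ S := by
    intro z hz
    apply hεK
    have : ‖z‖ ≤ 1 := by simpa using hz
    simp [dist_eq_norm, norm_smul, abs_of_pos hε]
    nlinarith
  have hcont : Continuous fun p : (E →L[ℝ] E) × E => |p.1.det| :=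
    (ContinuousLinearMap.continuous_det.comp continuous_fst).abs
  obtain ⟨⟨A, c⟩, hAS, hmax⟩ := hScomp.exists_isMaxOn ⟨_, hmem⟩ hcont.continuousOn
  have hdet : 0 < |A.det| := by
    have h1 := hmax hmem
    have h2 : (ε • ContinuousLinearMap.id ℝ E).det = ε ^ n := by
      change LinearMap.det (ε • LinearMap.id) = _
      rw [LinearMap.det_smul]; simp [E]
    simp only [mem_ofPred_eq] at h1
    rw [h2] at h1
    exact lt_of_lt_of_le (abs_pos.2 (pow_ne_zero _ hε.ne')) h1
  refine ⟨A, c, ?_, fun z hz => hAS z hz, ?_⟩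
  · have hu : IsUnit (LinearMap.det (A : E →ₗ[ℝ] E)) := (abs_pos.1 hdet).isUnit
    have := (LinearMap.isUnit_iff_isUnit_det (A : E →ₗ[ℝ] E)).2 hu
    exact ((Module.End.isUnit_iff _).1 this).2
  · intro y hy
    rw [mem_closedBall_zero_iff]
    by_contra hcon
    push Not at hcon
    rcases Nat.eq_zero_or_pos n with h0 | hn
    · subst h0
      have : y = 0 := Subsingleton.elim _ _
      simp [this] at hcon
    obtain ⟨A', c', hA', hd'⟩ := aux_bigger n hn {x | A x + c ∈ K} (hK.preimage (by fun_prop))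
      (by
        intro x hx y hy a b ha hb hab
        have := hKc hx hy ha hb hab
        simp only [mem_ofPred_eq, map_add, map_smul]
        convert this using 1
        rw [smul_add, smul_add, add_add_add_comm, ← add_smul, hab, one_smul])
      (fun z hz => hAS z hz) y hy hcon
    have hm : ((A.comp A', A c' + c) : (E →L[ℝ] E) × E) ∈ S := by
      intro z hz
      have := hA' z hz
      simpa [add_assoc] using this
    have h1 := hmax hm
    have h2 : (A.comp A').det = A.det * A'.det := by
      change LinearMap.det ((A : E →ₗ[ℝ] E) ∘ₗ (A' : E →ₗ[ℝ] E)) = _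
      rw [LinearMap.det_comp]
    simp only [mem_ofPred_eq] at h1
    rw [h2, abs_mul] at h1
    nlinarith

/-- Restricting a formulation to a proper affine subspace that still projects onto `P`. -/
lemma aux_restrict {d l m n : ℕ} (P : Set (EuclideanSpace ℝ (Fin d)))
    (φ : EuclideanSpace ℝ (Fin n) →ᵃ[ℝ] EuclideanSpace ℝ (Fin d))
    (M : Fin l → (EuclideanSpace ℝ (Fin n) →ᵃ[ℝ] Matrix (Fin m) (Fin m) ℝ))
    (hM : ∀ i x, (M i x).IsSymm) (hP : P = φ '' {x | ∀ i, (M i x).PosSemidef})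
    (W : Submodule ℝ (EuclideanSpace ℝ (Fin n))) (hW : W ≠ ⊤) (p : EuclideanSpace ℝ (Fin n))
    (hsub : ∀ q ∈ P, ∃ x, (∀ i, (M i x).PosSemidef) ∧ x - p ∈ W ∧ φ x = q) :
    ∃ k < n, ∃ (φ' : EuclideanSpace ℝ (Fin k) →ᵃ[ℝ] EuclideanSpace ℝ (Fin d))
    (M' : Fin l → (EuclideanSpace ℝ (Fin k) →ᵃ[ℝ] Matrix (Fin m) (Fin m) ℝ)),
    (∀ i x, (M' i x).IsSymm) ∧ P = φ' '' {x | ∀ i, (M' i x).PosSemidef} := by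
  have hlt : Module.finrank ℝ W < n := by
    have := Submodule.finrank_lt (lt_top_iff_ne_top.2 hW).ne
    rwa [finrank_euclideanSpace_fin] at this
  let e : EuclideanSpace ℝ (Fin (Module.finrank ℝ W)) ≃ₗ[ℝ] W :=
    LinearEquiv.ofFinrankEq _ _ (by simp)
  let ι : EuclideanSpace ℝ (Fin (Module.finrank ℝ W)) →ᵃ[ℝ] EuclideanSpace ℝ (Fin n) :=
    (W.subtype ∘ₗ e.toLinearMap).toAffineMap + AffineMap.const ℝ _ p
  have hι : ∀ x, ι x = (e x : EuclideanSpace ℝ (Fin n)) + p := fun x => rfl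
  refine ⟨_, hlt, φ.comp ι, fun i => (M i).comp ι, fun i x => hM i _, ?_⟩
  apply Subset.antisymm
  · intro q hq
    obtain ⟨x, hx, hxp, rfl⟩ := hsub q hq
    refine ⟨e.symm ⟨x - p, hxp⟩, ?_, ?_⟩
    · intro i
      simpa [hι] using hx i
    · simp [hι]
  · rintro q ⟨x, hx, rfl⟩
    rw [hP]
    exact ⟨ι x, fun i => hx i, rfl⟩

theorem statement6 (d l m : ℕ) (P : Set (EuclideanSpace ℝ (Fin d)))
    (hpoly : IsPolytope P)
    (hdim : 1 ≤ Module.finrank ℝ (affineSpan ℝ P).direction)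
    (hext : HasSdpExtBlocks P l m) :
    ∃ (n : ℕ) (φ : EuclideanSpace ℝ (Fin n) →ᵃ[ℝ] EuclideanSpace ℝ (Fin d))
      (M : Fin l → (EuclideanSpace ℝ (Fin n) →ᵃ[ℝ] Matrix (Fin m) (Fin m) ℝ)),
      (∀ i x, (M i x).IsSymm) ∧
      (∀ i, M i 0 = 1) ∧
      P = φ '' {x | ∀ i, (M i x).PosSemidef} ∧
      Metric.closedBall 0 1 ⊆ {x | ∀ i, (M i x).PosSemidef} ∧
      {x | ∀ i, (M i x).PosSemidef} ⊆ Metric.closedBall 0 n := by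
  classical
  -- P is nonempty
  have hPne : P.Nonempty := by
    rw [Set.nonempty_iff_ne_empty]
    rintro rfl
    simp at hdim
  obtain ⟨V, hV⟩ := hpoly
  have hPb : Bornology.IsBounded P := by
    rw [hV]; exact isBounded_convexHull.2 V.finite_toSet.isBounded
  -- choose a formulation of minimal dimension
  unfold HasSdpExtBlocks at hext
  let n := Nat.find hext
  obtain ⟨φ, M, hM, hP⟩ := Nat.find_spec hext
  change EuclideanSpace ℝ (Fin n) →ᵃ[ℝ] EuclideanSpace ℝ (Fin d) at φ
  have hmin : ∀ k < n, ¬ _ := fun k hk => Nat.find_min hext hk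
  have hW : ∀ (W : Submodule ℝ (EuclideanSpace ℝ (Fin n))) (p : EuclideanSpace ℝ (Fin n)),
    W ≠ ⊤ → ¬ (∀ q ∈ P, ∃ x, (∀ i, (M i x).PosSemidef) ∧ x - p ∈ W ∧ φ x = q) := by
    intro W p hW hsub
    obtain ⟨k, hk, h⟩ := aux_restrict P φ M hM hP W hW p hsub
    exact hmin k hk h
  obtain ⟨hQc, hQconv⟩ := aux_closed M hM
  set Q : Set (EuclideanSpace ℝ (Fin n)) := {x | ∀ i, (M i x).PosSemidef} with hQ
  have hQne : Q.Nonempty := by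
    rw [hP] at hPne; exact hPne.of_image
  -- nonempty interior
  have hQi : (interior Q).Nonempty := by
    rw [hQconv.interior_nonempty_iff_affineSpan_eq_top]
    by_contra hcon
    obtain ⟨p, hp⟩ := hQne
    refine hW (affineSpan ℝ Q).direction p ?_ ?_
    · rwa [Ne, AffineSubspace.direction_eq_top_iff_of_nonempty ⟨p, subset_affineSpan ℝ Q hp⟩]
    · intro q hq
      rw [hP] at hq
      obtain ⟨x, hx, rfl⟩ := hq
      exact ⟨x, hx, AffineSubspace.vsub_mem_direction (subset_affineSpan ℝ Q hx)
        (subset_affineSpan ℝ Q hp), rfl⟩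
  -- bounded
  have hQb : Bornology.IsBounded Q := by
    by_contra hcon
    obtain ⟨r, hr0, hr⟩ := not_bounded_iff_exists_ne_zero_mem_asymptoticCone.1 hcon
    have hray : ∀ x ∈ Q, ∀ t : ℝ, 0 ≤ t → t • r + x ∈ Q := fun x hx t ht =>
      hQconv.smul_vadd_mem_of_isClosed_of_mem_asymptoticCone hQc ht hr hx
    have hφ : ∀ x (t : ℝ), φ (t • r + x) = t • φ.linear r + φ x := by
      intro x t
      have := φ.map_vadd x (t • r)
      simpa using this
    have hφr : φ.linear r = 0 := by
      by_contra hne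
      obtain ⟨x, hx⟩ := hQne
      obtain ⟨ρ, hρ⟩ := hPb.subset_closedBall 0
      have hpos : 0 < ‖φ.linear r‖ := norm_pos_iff.2 hne
      have hxρ : ‖φ x‖ ≤ ρ := by
        have : φ x ∈ P := by rw [hP]; exact ⟨x, hx, rfl⟩
        simpa using hρ this
      have hρ0 : 0 ≤ ρ := (norm_nonneg _).trans hxρ
      set t := (2 * ρ + 1) / ‖φ.linear r‖ with ht
      have ht0 : 0 ≤ t := by positivity
      have h1 : ‖φ (t • r + x)‖ ≤ ρ := by
        have : φ (t • r + x) ∈ P := by rw [hP]; exact ⟨_, hray x hx t ht0, rfl⟩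
        simpa using hρ this
      have h2 : ‖t • φ.linear r‖ ≤ ρ + ρ := by
        calc ‖t • φ.linear r‖ = ‖φ (t • r + x) - φ x‖ := by rw [hφ]; simp
          _ ≤ ‖φ (t • r + x)‖ + ‖φ x‖ := norm_sub_le _ _
          _ ≤ _ := by linarith
      rw [norm_smul, Real.norm_of_nonneg ht0, ht, div_mul_cancel₀ _ hpos.ne'] at h2
      linarith
    have hch : ∀ v ∈ V, ∃ x ∈ Q, φ x = v := by
      intro v hv
      have : v ∈ P := by rw [hV]; exact subset_convexHull ℝ _ hv
      rw [hP] at this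
      exact this
    choose! g hgQ hg using hch
    obtain ⟨c, hc⟩ := (V.image fun v => (inner ℝ r (g v) : ℝ)).bddAbove
    have hrr : (0 : ℝ) < inner ℝ r r := real_inner_self_pos.2 hr0
    let f : EuclideanSpace ℝ (Fin n) →ₗ[ℝ] ℝ := (innerSL ℝ r).toLinearMap
    have hf : ∀ x, f x = inner ℝ r x := fun x => by simp [f]
    let p : EuclideanSpace ℝ (Fin n) := (c / inner ℝ r r) • r
    have hfp : f p = c := by
      rw [hf, inner_smul_right, div_mul_cancel₀ _ hrr.ne']
    have hfker : LinearMap.ker f ≠ ⊤ := by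
      intro h
      have : r ∈ LinearMap.ker f := by rw [h]; trivial
      rw [LinearMap.mem_ker, hf] at this
      exact hrr.ne' this
    refine hW (LinearMap.ker f) p hfker ?_
    have hconv : Convex ℝ (φ '' (Q ∩ {x | f x = c})) :=
      (hQconv.inter (convex_hyperplane f.isLinear c)).affine_image φ
    have hsub : P ⊆ φ '' (Q ∩ {x | f x = c}) := by
      rw [hV]
      refine convexHull_min ?_ hconv
      intro v hv
      have hv' : v ∈ V := hv
      have hle : inner ℝ r (g v) ≤ c := hc (by simpa using ⟨v, hv', rfl⟩)
      refine ⟨((c - inner ℝ r (g v)) / inner ℝ r r) • r + g v, ⟨hray _ (hgQ v hv') _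
        (div_nonneg (by linarith) hrr.le), ?_⟩, ?_⟩
      · change f _ = c
        rw [hf, inner_add_right, inner_smul_right, div_mul_cancel₀ _ hrr.ne']; ring
      · rw [hφ, hφr, hg v hv']; simp
    intro q hq
    obtain ⟨x, ⟨hxQ, hxc⟩, hxq⟩ := hsub hq
    refine ⟨x, hxQ, ?_, hxq⟩
    have hxc' : f x = c := hxc
    rw [LinearMap.mem_ker, map_sub, hxc', hfp, sub_self]
  -- John position
  obtain ⟨A, c, hA, hin, hout⟩ := aux_john n Q hQc hQconv hQb hQi
  let T : EuclideanSpace ℝ (Fin n) →ᵃ[ℝ] EuclideanSpace ℝ (Fin n) :=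
    (A : EuclideanSpace ℝ (Fin n) →ₗ[ℝ] EuclideanSpace ℝ (Fin n)).toAffineMap + AffineMap.const ℝ _ c
  have hT : ∀ x, T x = A x + c := fun x => rfl
  have hnorm : ∀ i, ∃ M' : EuclideanSpace ℝ (Fin n) →ᵃ[ℝ] Matrix (Fin m) (Fin m) ℝ,
      (∀ x, (M' x).IsSymm) ∧ M' 0 = 1 ∧
      ∀ x, (M' x).PosSemidef ↔ (((M i).comp T) x).PosSemidef := fun i =>
    aux_normalize ((M i).comp T) (fun x => hM i _) (fun x hx => hin hx i)
  choose M' hs h1 hiff using hnorm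
  have hset : {x | ∀ i, (M' i x).PosSemidef} = {x | A x + c ∈ Q} := by
    ext x
    exact forall_congr' fun i => hiff i x
  refine ⟨n, φ.comp T, M', hs, h1, ?_, ?_, ?_⟩
  · rw [hset, hP]
    apply Subset.antisymm
    · rintro _ ⟨x, hx, rfl⟩
      obtain ⟨z, hz⟩ := hA (x - c)
      have hz' : T z = x := by rw [hT, hz]; simp
      refine ⟨z, ?_, ?_⟩
      · change T z ∈ Q
        rw [hz']; exact hx
      · simp [hz']
    · rintro _ ⟨x, hx, rfl⟩
      exact ⟨T x, hx, rfl⟩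
  · rw [hset]; exact hin
  · rw [hset]; exact hout
end
end

section
/- Let d ∈ ℕ with d ≥ 3 and let ℓ, m ∈ ℕ. The number of 0/1-polytopes in ℝ^d of dimension at least one that have an extended formulation with ℓ LMIs of size m is at most 2^{32·ℓ²·m⁴·d²}. -/
open Metric Set

noncomputable section

namespace SdpCount

lemma sel {E : Type*} [AddCommGroup E] [Module ℝ E] [FiniteDimensional ℝ E] {J : Type*} [Finite J]
    [Nonempty J] (D : ℕ) (hD : Module.finrank ℝ E ≤ D) (r : J → E) :
    ∃ I : Fin D → J, ∀ j, ∃ α : Fin D → ℝ, (∀ i, |α i| ≤ 1) ∧ r j = ∑ i, α i • r (I i) := by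
  classical
  obtain ⟨f, hf, -, hli⟩ := Submodule.exists_fun_fin_finrank_span_eq ℝ (Set.range r)
  let F := Submodule.span ℝ (Set.range r)
  obtain ⟨t, ht⟩ := Nat.exists_eq_add_of_le ((Submodule.finrank_le F).trans hD)
  let r' : J → F := fun j => ⟨r j, Submodule.subset_span ⟨j, rfl⟩⟩
  let e := Module.finBasis ℝ F
  choose g0 hg0 using hf
  have key : ∀ g : Fin (Module.finrank ℝ F) → J, LinearIndependent ℝ (r' ∘ g) →
      ⊤ ≤ Submodule.span ℝ (Set.range (r' ∘ g)) := fun g hg =>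
    (LinearIndependent.span_eq_top_of_card_eq_finrank' hg (by simp)).ge
  have hli0 : LinearIndependent ℝ (r' ∘ g0) := by
    apply LinearIndependent.of_comp F.subtype
    have : F.subtype ∘ r' ∘ g0 = f := by
      funext i; simp [r', hg0]
    rw [this]; exact hli
  have hdet0 : e.det (r' ∘ g0) ≠ 0 :=
    (Module.Basis.is_basis_iff_det e |>.1 ⟨hli0, top_le_iff.1 (key _ hli0)⟩).ne_zero
  obtain ⟨g, hg⟩ := Finite.exists_max (fun g : Fin (Module.finrank ℝ F) → J => |e.det (r' ∘ g)|)
  have hdet : e.det (r' ∘ g) ≠ 0 := by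
    have := (abs_pos.2 hdet0).trans_le (hg g0)
    exact abs_pos.1 this
  obtain ⟨hlig, hspg⟩ := (Module.Basis.is_basis_iff_det e).2 (isUnit_iff_ne_zero.2 hdet)
  let b := Module.Basis.mk hlig hspg.ge
  have hb : ∀ j i, |b.coord i (r' j)| ≤ 1 := by
    intro j i
    have h1 := congrArg (fun L => L (r' j)) (e.det_smul_mk_coord_eq_det_update hlig hspg.ge i)
    simp only [LinearMap.smul_apply, smul_eq_mul, MultilinearMap.toLinearMap_apply] at h1
    have h2 : Function.update (r' ∘ g) i (r' j) = r' ∘ Function.update g i j := by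
      rw [Function.comp_update]
    rw [h2] at h1
    have h3 := hg (Function.update g i j)
    have h4 : e.det (r' ∘ g) * b.coord i (r' j) = e.det (r' ∘ Function.update g i j) := h1
    rw [← h4, abs_mul] at h3
    have := abs_pos.2 hdet
    by_contra hcon
    push Not at hcon
    nlinarith
  have hsum : ∀ j, r j = ∑ i, b.coord i (r' j) • r (g i) := by
    intro j
    have h1 := congrArg F.subtype (b.sum_repr (r' j))
    rw [map_sum] at h1
    have h2 : ∀ i, b i = r' (g i) := fun i => by simp [b]
    simp only [h2, map_smul] at h1
    exact h1.symm
  subst ht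
  refine ⟨Fin.append g (fun _ => Classical.arbitrary J), fun j =>
    ⟨Fin.append (fun i => b.coord i (r' j)) (fun _ => 0), ?_, ?_⟩⟩
  · intro i
    refine Fin.addCases (fun i => ?_) (fun i => ?_) i
    · rw [Fin.append_left]; exact hb j i
    · rw [Fin.append_right]; simp
  · rw [Fin.sum_univ_add]
    simp only [Fin.append_left, Fin.append_right, zero_smul, Finset.sum_const_zero, add_zero]
    exact hsum j

lemma round (Q d N : ℕ) (hQ : 0 < Q) (hN : 2 * d * Q < N) :
    ∃ r : ℝ → Fin N, ∀ x y : ℝ, |x| ≤ d → |y| ≤ d → r x = r y → |x - y| ≤ 1 / Q := by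
  refine ⟨fun x => if h : (⌊x * Q⌋ + d * Q).toNat < N then ⟨_, h⟩ else ⟨0, by omega⟩, ?_⟩
  have hQ' : (0 : ℝ) < Q := by exact_mod_cast hQ
  have hb : ∀ x : ℝ, |x| ≤ d → 0 ≤ ⌊x * Q⌋ + d * Q ∧ ⌊x * Q⌋ ≤ d * Q := by
    intro x hx
    rw [abs_le] at hx
    have h1 : (-(d * Q : ℤ)) ≤ ⌊x * Q⌋ := by
      rw [Int.le_floor]; push_cast; nlinarith
    have h2 : ⌊x * Q⌋ ≤ (d * Q : ℤ) := by
      have := Int.floor_le (x * Q)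
      have h3 : x * Q ≤ d * Q := by nlinarith
      exact_mod_cast this.trans h3
    omega
  intro x y hx hy hxy
  obtain ⟨a1, a2⟩ := hb x hx
  obtain ⟨b1, b2⟩ := hb y hy
  have hN' : (2 * (d * Q) : ℤ) < N := by exact_mod_cast (by linarith : 2 * (d * Q) < N)
  have c1 : (⌊x * Q⌋ + d * Q).toNat < N := by omega
  have c2 : (⌊y * Q⌋ + d * Q).toNat < N := by omega
  simp only [c1, c2, dif_pos, Fin.mk.injEq] at hxy
  have : ⌊x * Q⌋ = ⌊y * Q⌋ := by omega
  have h := Int.abs_sub_lt_one_of_floor_eq_floor this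
  rw [← sub_mul, abs_mul, abs_of_pos hQ'] at h
  rw [le_div_iff₀ hQ']; exact h.le

open Matrix

lemma psd_quad {m : ℕ} {A : Matrix (Fin m) (Fin m) ℝ} (hA : A.PosSemidef) (x : Fin m → ℝ) :
    0 ≤ x ⬝ᵥ (A *ᵥ x) := by
  simpa using hA.dotProduct_mulVec_nonneg x

lemma psd_symm {m : ℕ} {A : Matrix (Fin m) (Fin m) ℝ} (hA : A.PosSemidef) (i j : Fin m) :
    A i j = A j i := by
  have := congrFun (congrFun hA.1 j) i
  simpa [conjTranspose] using this

lemma psd_entry {m : ℕ} {A : Matrix (Fin m) (Fin m) ℝ} (hA : A.PosSemidef) (i j : Fin m) :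
    |A i j| ≤ (A i i + A j j) / 2 := by
  have h1 := psd_quad hA (Pi.single i 1 + Pi.single j 1)
  have h2 := psd_quad hA (Pi.single i 1 - Pi.single j 1)
  have hs := psd_symm hA i j
  simp only [mulVec_add, mulVec_sub, dotProduct_add, add_dotProduct, sub_dotProduct, dotProduct_sub,
    mulVec_single_one, single_one_dotProduct, col_apply] at h1 h2
  rw [abs_le]; constructor <;> linarith

lemma psd_entry_trace {m : ℕ} {A : Matrix (Fin m) (Fin m) ℝ} (hA : A.PosSemidef) (i j : Fin m) :
    |A i j| ≤ A.trace := by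
  have h : ∀ i, A i i ≤ A.trace := fun i =>
    Finset.single_le_sum (f := fun i => A i i) (fun i _ => hA.diag_nonneg) (Finset.mem_univ i)
  have := psd_entry hA i j
  linarith [h i, h j]

open scoped MatrixOrder in
lemma psd_fact {m : ℕ} {A : Matrix (Fin m) (Fin m) ℝ} (hA : A.PosSemidef) :
    ∃ B : Matrix (Fin m) (Fin m) ℝ, A = Bᴴ * B :=
  CStarAlgebra.nonneg_iff_eq_star_mul_self.mp hA.nonneg

lemma psd_trace_mul {m : ℕ} {A B : Matrix (Fin m) (Fin m) ℝ} (hA : A.PosSemidef)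
    (hB : B.PosSemidef) : 0 ≤ (A * B).trace := by
  obtain ⟨C, rfl⟩ := psd_fact hA
  rw [Matrix.mul_assoc, Matrix.trace_mul_comm]
  exact (hB.mul_mul_conjTranspose_same C).trace_nonneg

lemma normalise {m : ℕ} {ι J : Type*} [Fintype ι] [Nonempty ι] (W : ι → Matrix (Fin m) (Fin m) ℝ)
    (U : J → Matrix (Fin m) (Fin m) ℝ) (hW : ∀ i, (W i).PosSemidef) (hU : ∀ j, (U j).PosSemidef)
    (η : ℝ) (hη : 0 < η) :
    ∃ (W' : ι → Matrix (Fin m) (Fin m) ℝ) (U' : J → Matrix (Fin m) (Fin m) ℝ),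
      (∀ i, (W' i).PosSemidef) ∧ (∀ j, (U' j).PosSemidef) ∧
      (∀ j i, (U' j * W' i).trace = (U j * W i).trace) ∧
      (∀ j, (U' j).trace = (Fintype.card ι : ℝ)⁻¹ * ∑ i, (U j * W i).trace + η * (U j).trace) ∧
      ∀ i a b, |W' i a b| ≤ Fintype.card ι := by
  classical
  have hc : (0 : ℝ) < Fintype.card ι := by exact_mod_cast Fintype.card_pos
  set c : ℝ := (Fintype.card ι : ℝ) with hcdef
  set A : Matrix (Fin m) (Fin m) ℝ := c⁻¹ • ∑ i, W i + η • 1 with hAdef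
  have hS : (∑ i, W i).PosSemidef := posSemidef_sum _ fun i _ => hW i
  have hA : A.PosDef := by
    apply Matrix.PosDef.posSemidef_add
    · exact hS.smul (by positivity)
    · exact Matrix.PosDef.one.smul hη
  obtain ⟨B, hB⟩ := psd_fact hA.posSemidef
  have hBu : IsUnit B.det := by
    have := (Matrix.isUnit_iff_isUnit_det _).1 hA.isUnit
    rw [hB, det_mul] at this
    exact isUnit_of_mul_isUnit_right this
  have hBB : B⁻¹ * B = 1 := nonsing_inv_mul B hBu
  have hBB' : Bᴴ * (B⁻¹)ᴴ = 1 := by rw [← conjTranspose_mul, hBB, conjTranspose_one]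
  have hBB2 : B * B⁻¹ = 1 := mul_nonsing_inv B hBu
  have hBB2' : (B⁻¹)ᴴ * Bᴴ = 1 := by rw [← conjTranspose_mul, hBB2, conjTranspose_one]
  refine ⟨fun i => (B⁻¹)ᴴ * W i * B⁻¹, fun j => B * U j * Bᴴ,
    fun i => (hW i).conjTranspose_mul_mul_same _, fun j => (hU j).mul_mul_conjTranspose_same _,
    ?_, ?_, ?_⟩
  · intro j i
    have : B * U j * Bᴴ * ((B⁻¹)ᴴ * W i * B⁻¹) = B * (U j * W i * B⁻¹) := by
      calc _ = B * U j * (Bᴴ * (B⁻¹)ᴴ) * W i * B⁻¹ := by simp only [Matrix.mul_assoc]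
        _ = _ := by rw [hBB']; simp only [Matrix.mul_assoc, Matrix.mul_one]
    rw [this, trace_mul_comm, Matrix.mul_assoc, hBB, Matrix.mul_one]
  · intro j
    have : (B * U j * Bᴴ).trace = (U j * A).trace := by
      rw [hB, Matrix.mul_assoc, trace_mul_comm, Matrix.mul_assoc]
    simp only [this, hAdef, Matrix.mul_add, trace_add, Matrix.mul_smul, trace_smul, Matrix.mul_one,
      smul_eq_mul, Matrix.mul_sum, trace_sum]
  · intro i a b
    have hpsd := (hW i).conjTranspose_mul_mul_same B⁻¹
    have hle : (c • A - W i).PosSemidef := by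
      have h1 : c • A - W i = (∑ k ∈ Finset.univ.erase i, W k) + (c * η) • 1 := by
        rw [hAdef, smul_add, smul_smul, mul_inv_cancel₀ hc.ne', one_smul, smul_smul,
          ← Finset.add_sum_erase _ _ (Finset.mem_univ i)]
        abel
      rw [h1]
      exact (posSemidef_sum _ fun i _ => hW i).add (Matrix.PosSemidef.one.smul (by positivity))
    have h2 := hle.conjTranspose_mul_mul_same B⁻¹
    have h3 : (B⁻¹)ᴴ * (c • A - W i) * B⁻¹ = c • 1 - (B⁻¹)ᴴ * W i * B⁻¹ := by
      have : (B⁻¹)ᴴ * A * B⁻¹ = 1 := by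
        rw [hB]
        calc _ = ((B⁻¹)ᴴ * Bᴴ) * (B * B⁻¹) := by simp only [Matrix.mul_assoc]
          _ = 1 := by rw [hBB2, hBB2', Matrix.mul_one]
      rw [Matrix.mul_sub, Matrix.sub_mul, Matrix.mul_smul, Matrix.smul_mul, this]
    rw [h3] at h2
    have hd : ∀ a, ((B⁻¹)ᴴ * W i * B⁻¹) a a ≤ c := by
      intro a
      have := h2.diag_nonneg (i := a)
      simpa using this
    have := psd_entry hpsd a b
    linarith [hd a, hd b]


lemma bdd_dir {Y : Type*} [NormedAddCommGroup Y] [NormedSpace ℝ Y] (p q : Y) (R : ℝ)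
    (h : ∀ t : ℝ, 0 ≤ t → ‖p + t • q‖ ≤ R) : q = 0 := by
  by_contra hq
  have hq' : 0 < ‖q‖ := norm_pos_iff.2 hq
  have hR : 0 ≤ R := (norm_nonneg _).trans (h 0 le_rfl)
  have h1 := h ((R + ‖p‖ + 1) / ‖q‖) (by positivity)
  have h2 : ‖((R + ‖p‖ + 1) / ‖q‖) • q‖ = R + ‖p‖ + 1 := by
    rw [norm_smul, Real.norm_of_nonneg (by positivity), div_mul_cancel₀ _ hq'.ne']
  have h3 := norm_sub_le (p + ((R + ‖p‖ + 1) / ‖q‖) • q) p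
  rw [add_sub_cancel_left, h2] at h3
  linarith

lemma psd_of_trace {m : ℕ} {Y : Matrix (Fin m) (Fin m) ℝ} (hs : Y.IsSymm)
    (h : ∀ U : Matrix (Fin m) (Fin m) ℝ, U.PosSemidef → 0 ≤ (U * Y).trace) : Y.PosSemidef := by
  apply Matrix.PosSemidef.of_dotProduct_mulVec_nonneg
  · rw [Matrix.IsHermitian, conjTranspose_eq_transpose_of_trivial]; exact hs
  · intro x
    have := h _ (posSemidef_vecMulVec_self_star x)
    rw [trace_mul_comm, mul_vecMulVec, trace_vecMulVec, dotProduct_comm] at this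
    exact this

lemma dual {X Y : Type} [AddCommGroup X] [Module ℝ X] [NormedAddCommGroup Y] [NormedSpace ℝ Y]
    {l m : ℕ} (φ : X →ᵃ[ℝ] Y) (M : Fin l → (X →ᵃ[ℝ] Matrix (Fin m) (Fin m) ℝ))
    (hsym : ∀ i x, (M i x).IsSymm) (R : ℝ)
    (hbd : ∀ x, (∀ k, (M k x).PosSemidef) → ‖φ x‖ ≤ R) (h : Y →ᵃ[ℝ] ℝ)
    (hh : ∀ x, (∀ k, (M k x).PosSemidef) → 0 ≤ h (φ x))
    {ι : Type*} [Fintype ι] (x : ι → X) (hx : ∀ i k, (M k (x i)).PosSemidef) (a b : ι)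
    (hab : φ (x a) ≠ φ (x b)) (ε : ℝ) (hε : 0 < ε) :
    ∃ U : Fin l → Matrix (Fin m) (Fin m) ℝ, (∀ k, (U k).PosSemidef) ∧
      ∀ i, |h (φ (x i)) - ∑ k, (U k * M k (x i)).trace| ≤ ε := by
  classical
  let T : (Fin l → Matrix (Fin m) (Fin m) ℝ) → ι → ℝ := fun U i => ∑ k, (U k * M k (x i)).trace
  let C : Set (ι → ℝ) := {y | ∃ U, (∀ k, (U k).PosSemidef) ∧ T U = y}
  have hTadd : ∀ U U' (s t : ℝ), T (s • U + t • U') = s • T U + t • T U' := by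
    intro U U' s t
    funext i
    simp [T, Matrix.add_mul, Finset.sum_add_distrib, Finset.mul_sum]
  have hCconv : Convex ℝ C := by
    rintro _ ⟨U, hU, rfl⟩ _ ⟨U', hU', rfl⟩ s t hs ht -
    exact ⟨s • U + t • U', fun k => ((hU k).smul hs).add ((hU' k).smul ht), hTadd _ _ _ _⟩
  let p : ι → ℝ := fun i => h (φ (x i))
  by_cases hp : p ∈ closure C
  · obtain ⟨_, ⟨U, hU, rfl⟩, hd⟩ := Metric.mem_closure_iff.1 hp ε hε
    refine ⟨U, hU, fun i => ?_⟩
    have := (dist_le_pi_dist p (T U) i).trans hd.le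
    rwa [Real.dist_eq] at this
  exfalso
  obtain ⟨g, u, hgp, hgC⟩ := geometric_hahn_banach_point_closed hCconv.closure isClosed_closure hp
  let lam : ι → ℝ := fun i => g (Pi.single i 1)
  have hg : ∀ y, g y = ∑ i, lam i * y i := by
    intro y
    conv_lhs => rw [← Finset.univ_sum_single y]
    rw [map_sum]
    refine Finset.sum_congr rfl fun i _ => ?_
    have : Pi.single i (y i) = y i • (Pi.single i 1 : ι → ℝ) := by
      rw [← Pi.single_smul]; simp
    rw [this, map_smul, smul_eq_mul, mul_comm]
  have hC0 : u < 0 := by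
    have := hgC 0 (subset_closure ⟨0, fun k => Matrix.PosSemidef.zero, by funext i; simp [T]⟩)
    simpa using this
  have hCnn : ∀ U, (∀ k, (U k).PosSemidef) → 0 ≤ g (T U) := by
    intro U hU
    by_contra hneg
    push Not at hneg
    have h0 : 0 ≤ u / g (T U) := div_nonneg_of_nonpos hC0.le hneg.le
    have h1 := hgC ((u / g (T U)) • T U) (subset_closure
      ⟨(u / g (T U)) • U, fun k => (hU k).smul h0, by simpa using hTadd U 0 (u / g (T U)) 0⟩)
    rw [map_smul, smul_eq_mul, div_mul_cancel₀ _ hneg.ne] at h1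
    exact lt_irrefl _ h1
  have hgp0 : ∑ i, lam i * h (φ (x i)) < 0 := by
    rw [← hg p]; exact hgp.trans hC0
  let s : ℝ := ∑ i, lam i
  let z : X := ∑ i, lam i • x i
  -- affine maps on the combination
  have haff : ∀ {Z : Type _} [AddCommGroup Z] [Module ℝ Z] (f : X →ᵃ[ℝ] Z),
      ∑ i, lam i • f (x i) = f.linear z + s • f 0 := by
    intro Z _ _ f
    have : ∀ i, f (x i) = f.linear (x i) + f 0 := fun i => by
      have := congrFun f.decomp (x i); simpa using this
    simp only [this, smul_add, Finset.sum_add_distrib, z, s, map_sum, map_smul, Finset.sum_smul]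
  have haff1 : ∀ {Z : Type _} [AddCommGroup Z] [Module ℝ Z] (f : X →ᵃ[ℝ] Z) (y w : X),
      f (y + w) = f y + f.linear w := by
    intro Z _ _ f y w
    have := f.map_vadd y w
    simpa [add_comm] using this
  have hY : ∀ k, ((M k).linear z + s • M k 0).PosSemidef := by
    intro k
    rw [← haff (M k)]
    apply psd_of_trace
    · unfold Matrix.IsSymm
      rw [Matrix.transpose_sum]
      exact Finset.sum_congr rfl fun i _ => by rw [Matrix.transpose_smul, hsym]
    · intro U hU
      have h1 := hCnn (Pi.single k U) (by
        intro j
        by_cases hj : j = k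
        · subst hj; simpa using hU
        · simpa [hj] using Matrix.PosSemidef.zero)
      rw [hg] at h1
      have h2 : ∀ i, T (Pi.single k U) i = (U * M k (x i)).trace := by
        intro i
        simp only [T]
        rw [Finset.sum_eq_single k]
        · simp
        · intro j _ hj; simp [hj]
        · simp
      simp only [h2] at h1
      simpa [Matrix.mul_sum, trace_sum, Matrix.mul_smul, trace_smul] using h1
  have hsumh := haff (h.comp φ)
  simp only [AffineMap.comp_apply, smul_eq_mul, AffineMap.comp_linear,
    LinearMap.comp_apply] at hsumh
  rw [hsumh] at hgp0
  rcases lt_or_ge 0 s with hs | hs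
  · have hfeas : ∀ k, (M k (s⁻¹ • z)).PosSemidef := by
      intro k
      have h1 : M k (s⁻¹ • z) = s⁻¹ • ((M k).linear z + s • M k 0) := by
        have := haff1 (M k) 0 (s⁻¹ • z)
        rw [zero_add] at this
        rw [this, map_smul, smul_add, smul_smul, inv_mul_cancel₀ hs.ne', one_smul, add_comm]
      rw [h1]
      exact (hY k).smul (by positivity)
    have h1 := hh _ hfeas
    have h2 := haff1 (h.comp φ) 0 (s⁻¹ • z)
    rw [zero_add] at h2
    simp only [AffineMap.comp_apply, AffineMap.comp_linear, LinearMap.comp_apply, map_smul,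
      smul_eq_mul] at h2
    rw [h2] at h1
    have h3 : s * (h (φ 0) + s⁻¹ * h.linear (φ.linear z)) = h.linear (φ.linear z) + s * h (φ 0) := by
      field_simp; ring
    have := mul_nonneg hs.le h1
    linarith
  · have hdir : ∀ i, φ.linear (z + (-s) • x i) = 0 := by
      intro i
      apply bdd_dir (φ (x i)) _ R
      intro t ht
      rw [← map_smul, ← haff1]
      apply hbd
      intro k
      rw [haff1, map_smul]
      apply (hx i k).add
      apply Matrix.PosSemidef.smul _ ht
      have h1 : (M k).linear (z + (-s) • x i)
          = ((M k).linear z + s • M k 0) + (-s) • M k (x i) := by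
        have := haff1 (M k) 0 (x i)
        rw [zero_add] at this
        rw [this, map_add, map_smul]
        module
      rw [h1]
      exact (hY k).add ((hx i k).smul (by linarith))
    rcases hs.lt_or_eq with hs | hs
    · have h1 : φ.linear (x a) = φ.linear (x b) := by
        have h2 := (hdir a).trans (hdir b).symm
        rw [map_add, map_add, map_smul, map_smul] at h2
        exact smul_right_injective Y (neg_ne_zero.2 hs.ne) (add_left_cancel h2)
      apply hab
      have ha := haff1 φ 0 (x a)
      have hb := haff1 φ 0 (x b)
      rw [zero_add] at ha hb
      rw [ha, hb, h1]
    · have h1 := hdir a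
      rw [hs, neg_zero, zero_smul, add_zero] at h1
      rw [h1, hs] at hgp0
      simp at hgp0


def pt {d : ℕ} (v : Fin d → Bool) : EuclideanSpace ℝ (Fin d) :=
  WithLp.toLp 2 (fun i => if v i then 1 else 0)

def ca {d : ℕ} (v : Fin d → Bool) : ℝ := (∑ i, if v i then 1 else 0) - 1

def cc {d : ℕ} (v : Fin d → Bool) (i : Fin d) : ℝ := if v i then -1 else 1

/-- The slack of the inequality Hamming distance to `v` at least one at `w`. -/
def fs {d : ℕ} (v w : Fin d → Bool) : ℝ := ca v + ∑ i, cc v i * pt w i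

lemma fs_eq {d : ℕ} (v w : Fin d → Bool) :
    fs v w = (∑ i, if v i = w i then (0 : ℝ) else 1) - 1 := by
  have : ∀ i, (if v i = w i then (0 : ℝ) else 1) = (if v i then 1 else 0) + cc v i * pt w i := by
    intro i
    simp only [cc, pt]
    cases v i <;> cases w i <;> simp
  simp only [fs, ca, this, Finset.sum_add_distrib]
  ring

lemma fs_self {d : ℕ} (v : Fin d → Bool) : fs v v = -1 := by simp [fs_eq]

lemma fs_nonneg {d : ℕ} {v w : Fin d → Bool} (h : v ≠ w) : 0 ≤ fs v w := by
  obtain ⟨i, hi⟩ := Function.ne_iff.1 h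
  have := Finset.single_le_sum (f := fun i => if v i = w i then (0 : ℝ) else 1)
    (fun i _ => by split_ifs <;> norm_num) (Finset.mem_univ i)
  simp only [hi, if_false] at this
  rw [fs_eq]; linarith

lemma fs_le {d : ℕ} (v w : Fin d → Bool) : fs v w ≤ d - 1 := by
  have := Finset.sum_le_sum (s := Finset.univ) (f := fun i => if v i = w i then (0 : ℝ) else 1)
    (g := fun _ => 1) (fun i _ => by split_ifs <;> norm_num)
  simp only [Finset.sum_const, Finset.card_univ, Fintype.card_fin, nsmul_eq_mul, mul_one] at this
  rw [fs_eq]; linarith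

def fh {d : ℕ} (v : Fin d → Bool) : EuclideanSpace ℝ (Fin d) →ᵃ[ℝ] ℝ :=
  (∑ i, cc v i • (EuclideanSpace.proj i : EuclideanSpace ℝ (Fin d) →L[ℝ] ℝ).toLinearMap).toAffineMap
    + AffineMap.const ℝ _ (ca v)

lemma fh_pt {d : ℕ} (v w : Fin d → Bool) : fh v (pt w) = fs v w := by
  simp [fh, fs, add_comm]

lemma pt_inj {d : ℕ} : Function.Injective (pt (d := d)) := by
  intro v w h
  funext i
  have : pt v i = pt w i := by rw [h]
  simp only [pt] at this
  cases hv : v i <;> cases hw : w i <;> simp_all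

lemma setup {d l m : ℕ} (P : Set (EuclideanSpace ℝ (Fin d))) (hP : IsZeroOnePolytope P)
    (hdim : 1 ≤ Module.finrank ℝ (affineSpan ℝ P).direction) (hext : HasSdpExtBlocks P l m) :
    ∃ V : Set (Fin d → Bool), P = convexHull ℝ (pt '' V) ∧ V.Nonempty ∧
      ∃ W : (Fin d → Bool) → Fin l → Matrix (Fin m) (Fin m) ℝ,
        (∀ w ∈ V, ∀ k, (W w k).PosSemidef) ∧
        ∀ h : EuclideanSpace ℝ (Fin d) →ᵃ[ℝ] ℝ, (∀ w ∈ V, 0 ≤ h (pt w)) → ∀ ε : ℝ, 0 < ε →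
          ∃ U : Fin l → Matrix (Fin m) (Fin m) ℝ, (∀ k, (U k).PosSemidef) ∧
            ∀ w ∈ V, |h (pt w) - ∑ k, (U k * W w k).trace| ≤ ε := by
  classical
  obtain ⟨V0, hV0, hPV0⟩ := hP
  let V : Set (Fin d → Bool) := {b | pt b ∈ V0}
  have hV : pt '' V = V0 := by
    ext y
    constructor
    · rintro ⟨b, hb, rfl⟩; exact hb
    · intro hy
      have : pt (fun i => decide (y i = 1)) = y := by
        ext i
        simp only [pt]
        rcases hV0 hy i with h | h <;> simp [h]
      exact ⟨fun i => decide (y i = 1), by simpa [V, this] using hy, this⟩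
  have hPV : P = convexHull ℝ (pt '' V) := by rw [hV, hPV0]
  obtain ⟨n, φ, M, hsym, hPφ⟩ := hext
  have hns : ¬ V.Subsingleton := by
    intro hs
    have h1 : (pt '' V).Subsingleton := hs.image _
    rw [hPV, affineSpan_convexHull, direction_affineSpan, vectorSpan_of_subsingleton ℝ h1] at hdim
    simp at hdim
  rw [Set.not_subsingleton_iff] at hns
  obtain ⟨a, ha, b, hb, hab⟩ := hns
  have hptP : ∀ w ∈ V, pt w ∈ P := fun w hw => by
    rw [hPV]; exact subset_convexHull ℝ _ ⟨w, hw, rfl⟩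
  have hex : ∀ w : V, ∃ x, (∀ k, (M k x).PosSemidef) ∧ φ x = pt w.1 := by
    intro w
    have := hptP w.1 w.2
    rw [hPφ] at this
    exact this
  choose x hx hφx using hex
  have hbdP : Bornology.IsBounded P := by
    rw [hPV, isBounded_convexHull]
    exact (Set.toFinite _).isBounded
  obtain ⟨R, hR⟩ := isBounded_iff_forall_norm_le.1 hbdP
  have hfe : ∀ x, (∀ k, (M k x).PosSemidef) → φ x ∈ P := fun x hx => by
    rw [hPφ]; exact ⟨x, hx, rfl⟩
  refine ⟨V, hPV, ⟨a, ha⟩, fun w k => if hw : w ∈ V then M k (x ⟨w, hw⟩) else 0, ?_, ?_⟩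
  · intro w hw k
    simp only [hw, dif_pos]
    exact hx ⟨w, hw⟩ k
  · intro h hh ε hε
    have hhP : ∀ y ∈ P, 0 ≤ h y := by
      intro y hy
      rw [hPV] at hy
      have : convexHull ℝ (pt '' V) ⊆ h ⁻¹' Set.Ici 0 :=
        convexHull_min (by rintro _ ⟨w, hw, rfl⟩; exact hh w hw)
          ((convex_Ici (0 : ℝ)).affine_preimage h)
      exact this hy
    obtain ⟨U, hU, hUe⟩ := dual φ M hsym R (fun x hx => hR _ (hfe x hx)) h
      (fun x hx => hhP _ (hfe x hx)) x hx ⟨a, ha⟩ ⟨b, hb⟩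
      (by rw [hφx, hφx]; exact fun h => hab (pt_inj h)) ε hε
    refine ⟨U, hU, fun w hw => ?_⟩
    have := hUe ⟨w, hw⟩
    rw [hφx] at this
    simpa only [hw, dif_pos] using this

lemma data {d l m : ℕ} (P : Set (EuclideanSpace ℝ (Fin d))) (hP : IsZeroOnePolytope P)
    (hdim : 1 ≤ Module.finrank ℝ (affineSpan ℝ P).direction) (hext : HasSdpExtBlocks P l m)
    (ε : ℝ) (hε : 0 < ε) (hε4 : ε ≤ 1 / 4) :
    ∃ V : Set (Fin d → Bool), P = convexHull ℝ (pt '' V) ∧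
      ∃ W U : (Fin d → Bool) → Fin l → Matrix (Fin m) (Fin m) ℝ,
        (∀ w ∈ V, ∀ k, (W w k).PosSemidef) ∧
        (∀ w ∈ V, ∀ k a b, |W w k a b| ≤ 2 ^ d) ∧
        (∀ v, v ∉ V → ∀ k, (U v k).PosSemidef) ∧
        (∀ v, v ∉ V → ∀ k a b, |U v k a b| ≤ d) ∧
        ∀ v, v ∉ V → ∀ w ∈ V, |fs v w - ∑ k, (U v k * W w k).trace| ≤ ε := by
  classical
  obtain ⟨V, hPV, ⟨a, ha⟩, W, hW, hd⟩ := setup P hP hdim hext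
  have h1 : ∀ v : {v // v ∉ V}, ∃ U : Fin l → Matrix (Fin m) (Fin m) ℝ, (∀ k, (U k).PosSemidef) ∧
      ∀ w ∈ V, |fs v.1 w - ∑ k, (U k * W w k).trace| ≤ ε := by
    intro v
    obtain ⟨U, hU, h⟩ := hd (fh v.1) (fun w hw => by
      rw [fh_pt]; exact fs_nonneg (fun h => v.2 (h ▸ hw))) ε hε
    exact ⟨U, hU, fun w hw => by rw [← fh_pt]; exact h w hw⟩
  choose U hU hUe using h1
  let S : ℝ := ∑ v, ∑ k, (U v k).trace
  have hS : ∀ v, ∑ k, (U v k).trace ≤ S := fun v =>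
    Finset.single_le_sum (f := fun v => ∑ k, (U v k).trace)
      (fun v _ => Finset.sum_nonneg fun k _ => (hU v k).trace_nonneg) (Finset.mem_univ v)
  have hS0 : 0 ≤ S :=
    Finset.sum_nonneg fun v _ => Finset.sum_nonneg fun k _ => (hU v k).trace_nonneg
  let η : ℝ := 1 / (4 * (S + 1))
  have hη : 0 < η := by positivity
  have hηS : η * S ≤ 1 / 4 := by
    simp only [η]
    rw [div_mul_eq_mul_div, div_le_div_iff₀ (by positivity) (by norm_num)]
    linarith
  have : Nonempty V := ⟨⟨a, ha⟩⟩
  have hn := fun k => normalise (fun w : V => W w.1 k) (fun v => U v k) (fun w => hW w.1 w.2 k)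
    (fun v => hU v k) η hη
  choose W' U' hW' hU' hUW htr hWb using hn
  have hcpos : (0 : ℝ) < Fintype.card V := by exact_mod_cast Fintype.card_pos
  have hcard : (Fintype.card V : ℝ) ≤ 2 ^ d := by
    have := Fintype.card_subtype_le (fun x => x ∈ V)
    have h2 : Fintype.card (Fin d → Bool) = 2 ^ d := by simp
    rw [h2] at this
    exact_mod_cast this
  have htrace : ∀ v, ∑ k, (U' k v).trace ≤ d := by
    intro v
    have e1 : ∑ k, (U' k v).trace = (Fintype.card V : ℝ)⁻¹ * ∑ w : V, ∑ k, (U v k * W w.1 k).trace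
        + η * ∑ k, (U v k).trace := by
      simp only [htr]
      rw [Finset.sum_add_distrib, ← Finset.mul_sum, ← Finset.mul_sum, Finset.sum_comm]
    have e2 : ∑ w : V, ∑ k, (U v k * W w.1 k).trace ≤ ∑ w : V, ((d : ℝ) - 1 + 1 / 4) := by
      refine Finset.sum_le_sum fun w _ => ?_
      have := (abs_le.1 (hUe v w.1 w.2)).1
      linarith [fs_le v.1 w.1]
    rw [Finset.sum_const, Finset.card_univ, nsmul_eq_mul] at e2
    have e3 := mul_le_mul_of_nonneg_left e2 (inv_nonneg.2 hcpos.le)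
    rw [inv_mul_cancel_left₀ hcpos.ne'] at e3
    have e4 := mul_le_mul_of_nonneg_left (hS v) hη.le
    rw [e1]; linarith
  refine ⟨V, hPV, fun w k => if hw : w ∈ V then W' k ⟨w, hw⟩ else 0,
    fun v k => if hv : v ∉ V then U' k ⟨v, hv⟩ else 0, ?_, ?_, ?_, ?_, ?_⟩
  · intro w hw k
    simp only [hw, dif_pos]; exact hW' k _
  · intro w hw k a b
    simp only [hw, dif_pos]; exact (hWb k _ a b).trans hcard
  · intro v hv k
    simp only [hv, not_false_eq_true, dif_pos]; exact hU' k _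
  · intro v hv k a b
    simp only [hv, not_false_eq_true, dif_pos]
    refine (psd_entry_trace (hU' k _) a b).trans (le_trans ?_ (htrace ⟨v, hv⟩))
    exact Finset.single_le_sum (f := fun k => (U' k ⟨v, hv⟩).trace)
      (fun k _ => (hU' k _).trace_nonneg) (Finset.mem_univ k)
  · intro v hv w hw
    simp only [hv, hw, not_false_eq_true, dif_pos, hUW]
    exact hUe ⟨v, hv⟩ w hw


/-- The normalised data attached to a vertex set. -/
def Dat {d l m : ℕ} (ε : ℝ) (V : Set (Fin d → Bool))
    (W U : (Fin d → Bool) → Fin l → Matrix (Fin m) (Fin m) ℝ) : Prop :=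
  (∀ w ∈ V, ∀ k, (W w k).PosSemidef) ∧
  (∀ w ∈ V, ∀ k a b, |W w k a b| ≤ 2 ^ d) ∧
  (∀ v, v ∉ V → ∀ k, (U v k).PosSemidef) ∧
  (∀ v, v ∉ V → ∀ k a b, |U v k a b| ≤ d) ∧
  ∀ v, v ∉ V → ∀ w ∈ V, |fs v w - ∑ k, (U v k * W w k).trace| ≤ ε

/-- The row vector attached to `v`. -/
def row {d l m : ℕ} (U : (Fin d → Bool) → Fin l → Matrix (Fin m) (Fin m) ℝ) (v : Fin d → Bool) :
    ℝ × (Fin d → ℝ) × (Fin l → Matrix (Fin m) (Fin m) ℝ) := (ca v, cc v, U v)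

/-- The linear functional measuring the error. -/
def err {d l m : ℕ} (w : Fin d → Bool) (W : Fin l → Matrix (Fin m) (Fin m) ℝ) :
    (ℝ × (Fin d → ℝ) × (Fin l → Matrix (Fin m) (Fin m) ℝ)) →ₗ[ℝ] ℝ where
  toFun q := q.1 + ∑ i, q.2.1 i * pt w i - ∑ k, (q.2.2 k * W k).trace
  map_add' p q := by
    simp only [Prod.fst_add, Prod.snd_add, Pi.add_apply, add_mul, Matrix.add_mul, trace_add,
      Finset.sum_add_distrib]
    ring
  map_smul' c q := by
    simp only [Prod.smul_fst, Prod.smul_snd, Pi.smul_apply, smul_eq_mul, Matrix.smul_mul,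
      trace_smul, RingHom.id_apply, mul_assoc, ← Finset.mul_sum]
    ring

lemma err_row {d l m : ℕ} (U : (Fin d → Bool) → Fin l → Matrix (Fin m) (Fin m) ℝ)
    (v w : Fin d → Bool) (W : Fin l → Matrix (Fin m) (Fin m) ℝ) :
    err w W (row U v) = fs v w - ∑ k, (U v k * W k).trace := rfl

lemma trace_diff {l m : ℕ} (A B W : Fin l → Matrix (Fin m) (Fin m) ℝ) (δ c : ℝ) (hδ : 0 ≤ δ)
    (h : ∀ k a b, |A k a b - B k a b| ≤ δ) (hW : ∀ k a b, |W k a b| ≤ c) :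
    |∑ k, (A k * W k).trace - ∑ k, (B k * W k).trace| ≤ (l * m * m : ℝ) * (δ * c) := by
  have e : ∑ k, (A k * W k).trace - ∑ k, (B k * W k).trace
      = ∑ k, ∑ a, ∑ b, (A k a b - B k a b) * W k b a := by
    simp only [← Finset.sum_sub_distrib, Matrix.trace, Matrix.diag, Matrix.mul_apply, sub_mul]
  rw [e]
  have h0 : ∀ k a b, |(A k a b - B k a b) * W k b a| ≤ δ * c := by
    intro k a b
    rw [abs_mul]
    exact mul_le_mul (h k a b) (hW k b a) (abs_nonneg _) hδ
  calc _ ≤ ∑ k : Fin l, ∑ a : Fin m, ∑ b : Fin m, δ * c := by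
        refine (Finset.abs_sum_le_sum_abs _ _).trans (Finset.sum_le_sum fun k _ => ?_)
        refine (Finset.abs_sum_le_sum_abs _ _).trans (Finset.sum_le_sum fun a _ => ?_)
        exact (Finset.abs_sum_le_sum_abs _ _).trans (Finset.sum_le_sum fun b _ => h0 k a b)
    _ = _ := by simp; ring

lemma sep {d l m D : ℕ} {ε δ : ℝ} (hδ : 0 ≤ δ) {V V' : Set (Fin d → Bool)}
    {W U W' U' : (Fin d → Bool) → Fin l → Matrix (Fin m) (Fin m) ℝ}
    (h : Dat ε V W U) (h' : Dat ε V' W' U') (I : Fin D → Fin d → Bool)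
    (hI : ∀ i, I i ∉ V)
    (hrep : ∀ v, v ∉ V' → ∃ α : Fin D → ℝ, (∀ i, |α i| ≤ 1) ∧
      row U' v = ∑ i, α i • row U' (I i))
    (hclose : ∀ i k a b, |U (I i) k a b - U' (I i) k a b| ≤ δ)
    (hnum : D * (ε + (l * m * m : ℝ) * (δ * 2 ^ d)) < 1) : V ⊆ V' := by
  intro w hw
  by_contra hw'
  obtain ⟨hW, hWb, -, -, he⟩ := h
  obtain ⟨-, -, hU', -, -⟩ := h'
  obtain ⟨α, hα, hr⟩ := hrep w hw'
  have h1 := congrArg (err w (W w)) hr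
  rw [map_sum, err_row, fs_self] at h1
  simp only [map_smul, smul_eq_mul, err_row] at h1
  have h2 : 0 ≤ ∑ k, (U' w k * W w k).trace :=
    Finset.sum_nonneg fun k _ => psd_trace_mul (hU' w hw' k) (hW w hw k)
  have h3 : ∀ i, |α i * (fs (I i) w - ∑ k, (U' (I i) k * W w k).trace)|
      ≤ ε + (l * m * m : ℝ) * (δ * 2 ^ d) := by
    intro i
    have t1 := trace_diff (U (I i)) (U' (I i)) (W w) δ (2 ^ d) hδ (hclose i) (hWb w hw)
    have t2 := he (I i) (hI i) w hw
    have t3 : |fs (I i) w - ∑ k, (U' (I i) k * W w k).trace|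
        ≤ ε + (l * m * m : ℝ) * (δ * 2 ^ d) := by
      have := abs_add_le (fs (I i) w - ∑ k, (U (I i) k * W w k).trace)
        (∑ k, (U (I i) k * W w k).trace - ∑ k, (U' (I i) k * W w k).trace)
      rw [sub_add_sub_cancel] at this
      linarith
    rw [abs_mul]
    have := mul_le_mul (hα i) t3 (abs_nonneg _) zero_le_one
    linarith
  have h4 : |∑ i, α i * (fs (I i) w - ∑ k, (U' (I i) k * W w k).trace)|
      ≤ D * (ε + (l * m * m : ℝ) * (δ * 2 ^ d)) := by
    refine (Finset.abs_sum_le_sum_abs _ _).trans ((Finset.sum_le_sum fun i _ => h3 i).trans ?_)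
    rw [Finset.sum_const, Finset.card_univ, Fintype.card_fin, nsmul_eq_mul]
  rw [← h1, abs_le] at h4
  linarith

abbrev Code (d l m D N : ℕ) : Type :=
  Bool × (Fin D → Fin d → Bool) × (Fin D → Fin l → Fin m → Fin m → Fin N)

def Good {d l m D N : ℕ} (ε : ℝ) (r : ℝ → Fin N) (P : Set (EuclideanSpace ℝ (Fin d)))
    (c : Code d l m D N) : Prop :=
  ∃ V : Set (Fin d → Bool), P = convexHull ℝ (pt '' V) ∧
    ∃ W U : (Fin d → Bool) → Fin l → Matrix (Fin m) (Fin m) ℝ, Dat ε V W U ∧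
      (c.1 = true ↔ V = Set.univ) ∧
      (V ≠ Set.univ → (∀ i, c.2.1 i ∉ V) ∧
        (∀ v, v ∉ V → ∃ α : Fin D → ℝ, (∀ i, |α i| ≤ 1) ∧
          row U v = ∑ i, α i • row U (c.2.1 i)) ∧
        ∀ i k a b, c.2.2 i k a b = r (U (c.2.1 i) k a b))

lemma good_exists {d l m D N : ℕ} (hD : 1 + d + l * m * m ≤ D) (ε : ℝ) (hε : 0 < ε)
    (hε4 : ε ≤ 1 / 4) (r : ℝ → Fin N)
    (P : Set (EuclideanSpace ℝ (Fin d))) (hP : IsZeroOnePolytope P)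
    (hdim : 1 ≤ Module.finrank ℝ (affineSpan ℝ P).direction) (hext : HasSdpExtBlocks P l m) :
    ∃ c : Code d l m D N, Good ε r P c := by
  classical
  obtain ⟨V, hPV, W, U, hdat⟩ := data P hP hdim hext ε hε hε4
  by_cases hV : V = Set.univ
  · exact ⟨(true, fun _ _ => true, fun _ _ _ _ => r 0), V, hPV, W, U, hdat, by simpa using hV,
      fun h => absurd hV h⟩
  · obtain ⟨v0, hv0⟩ := (Set.ne_univ_iff_exists_notMem V).1 hV
    have : Nonempty {v // v ∉ V} := ⟨⟨v0, hv0⟩⟩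
    obtain ⟨I, hI⟩ := sel (J := {v // v ∉ V})
      (E := ℝ × (Fin d → ℝ) × (Fin l → Matrix (Fin m) (Fin m) ℝ)) D
      (by
        refine le_trans (le_of_eq ?_) hD
        simp [Module.finrank_prod, Module.finrank_pi_fintype, Module.finrank_matrix]
        ring) (fun v => row U v.1)
    refine ⟨(false, fun i => (I i).1, fun i k a b => r (U (I i).1 k a b)), V, hPV, W, U, hdat,
      by simpa using hV, fun _ => ⟨fun i => (I i).2, fun v hv => hI ⟨v, hv⟩, fun _ _ _ _ => rfl⟩⟩

lemma good_inj {d l m D N Q : ℕ} {ε : ℝ} {r : ℝ → Fin N}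
    (hr : ∀ x y : ℝ, |x| ≤ d → |y| ≤ d → r x = r y → |x - y| ≤ 1 / Q)
    (hnum : D * (ε + (l * m * m : ℝ) * (1 / Q * 2 ^ d)) < 1)
    {P P' : Set (EuclideanSpace ℝ (Fin d))} {c : Code d l m D N}
    (h : Good ε r P c) (h' : Good ε r P' c) : P = P' := by
  obtain ⟨V, hPV, W, U, hdat, hu, hc⟩ := h
  obtain ⟨V', hPV', W', U', hdat', hu', hc'⟩ := h'
  have hVV : V = V' := by
    by_cases hV : V = Set.univ
    · rw [hV, eq_comm, ← hu', hu, hV]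
    · have hV' : V' ≠ Set.univ := fun h => hV (hu.1 (hu'.2 h))
      obtain ⟨a1, a2, a3⟩ := hc hV
      obtain ⟨b1, b2, b3⟩ := hc' hV'
      have hcl : ∀ i k a b, |U (c.2.1 i) k a b - U' (c.2.1 i) k a b| ≤ 1 / Q := fun i k a b =>
        hr _ _ (hdat.2.2.2.1 _ (a1 i) k a b) (hdat'.2.2.2.1 _ (b1 i) k a b)
          (by rw [← a3, ← b3])
      refine Set.Subset.antisymm (sep (by positivity) hdat hdat' _ a1 b2 hcl hnum)
        (sep (by positivity) hdat' hdat _ b1 a2 (fun i k a b => ?_) hnum)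
      rw [abs_sub_comm]; exact hcl i k a b
  rw [hPV, hPV', hVV]

lemma ncard_of_code {X C : Type*} [Fintype C] (S : Set X) (G : X → C → Prop)
    (h1 : ∀ x ∈ S, ∃ c, G x c) (h2 : ∀ x y c, G x c → G y c → x = y) :
    S.Finite ∧ S.ncard ≤ Fintype.card C := by
  have h3 : ∀ x : S, ∃ c, G x.1 c := fun x => h1 x.1 x.2
  choose f hf using h3
  have hinj : Function.Injective f := by
    intro x y hxy
    apply Subtype.ext
    exact h2 _ _ (f x) (hf x) (hxy ▸ hf y)
  refine ⟨Set.finite_coe_iff.1 (Finite.of_injective f hinj), ?_⟩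
  rw [← Nat.card_eq_fintype_card]
  exact Nat.card_le_card_of_injective f hinj

lemma card_arith (d l m : ℕ) (hd : 3 ≤ d) (hn : 1 ≤ l * m * m)
    (hbig : 32 * l ^ 2 * m ^ 4 * d ^ 2 < 2 ^ d) :
    2 * d * (4 * (1 + d + l * m * m) * (l * m * m) * 2 ^ d) < 2 ^ (2 * d) ∧
    Fintype.card (Code d l m (1 + d + l * m * m) (2 ^ (2 * d)))
      ≤ 2 ^ (32 * l ^ 2 * m ^ 4 * d ^ 2) := by
  have e : 32 * l ^ 2 * m ^ 4 * d ^ 2 = 32 * ((l * m * m) * d) ^ 2 := by ring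
  have ec : Fintype.card (Code d l m (1 + d + l * m * m) (2 ^ (2 * d)))
      = 2 ^ (1 + (1 + d + l * m * m) * (d + 2 * d * (l * m * m))) := by
    simp only [Fintype.card_prod, Fintype.card_bool, Fintype.card_fun, Fintype.card_fin, ← pow_mul]
    rw [← pow_add, ← pow_succ']
    congr 1
    ring
  rw [ec]
  rw [e] at hbig ⊢
  generalize l * m * m = n at *
  have hD : 1 + d + n ≤ 2 * (n * d) := by nlinarith
  have hpos : 0 < 2 ^ d := by positivity
  have hnd : 1 ≤ n * d := by nlinarith
  constructor
  · have : 2 * d * (4 * (1 + d + n) * n) < 2 ^ d := by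
      calc 2 * d * (4 * (1 + d + n) * n) = 8 * (n * d) * (1 + d + n) := by ring
        _ ≤ 8 * (n * d) * (2 * (n * d)) := Nat.mul_le_mul_left _ hD
        _ ≤ 32 * (n * d) ^ 2 := by nlinarith
        _ < _ := hbig
    calc 2 * d * (4 * (1 + d + n) * n * 2 ^ d) = (2 * d * (4 * (1 + d + n) * n)) * 2 ^ d := by ring
      _ < 2 ^ d * 2 ^ d := Nat.mul_lt_mul_of_pos_right this hpos
      _ = 2 ^ (2 * d) := by ring
  · apply Nat.pow_le_pow_right (by norm_num)
    have h1 : d + 2 * d * n ≤ 3 * (n * d) := by nlinarith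
    calc 1 + (1 + d + n) * (d + 2 * d * n) ≤ 1 + (2 * (n * d)) * (3 * (n * d)) :=
          Nat.add_le_add_left (Nat.mul_le_mul hD h1) _
      _ ≤ 32 * (n * d) ^ 2 := by nlinarith

end SdpCount

theorem statement11 (d l m : ℕ) (hd : 3 ≤ d) :
    {P : Set (EuclideanSpace ℝ (Fin d)) | IsZeroOnePolytope P ∧
        1 ≤ Module.finrank ℝ (affineSpan ℝ P).direction ∧ HasSdpExtBlocks P l m}.Finite ∧
    {P : Set (EuclideanSpace ℝ (Fin d)) | IsZeroOnePolytope P ∧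
        1 ≤ Module.finrank ℝ (affineSpan ℝ P).direction ∧ HasSdpExtBlocks P l m}.ncard
      ≤ 2 ^ (32 * l ^ 2 * m ^ 4 * d ^ 2) := by
  classical
  by_cases hn : l * m * m = 0
  · have hempty : {P : Set (EuclideanSpace ℝ (Fin d)) | IsZeroOnePolytope P ∧
        1 ≤ Module.finrank ℝ (affineSpan ℝ P).direction ∧ HasSdpExtBlocks P l m} = ∅ := by
      rw [Set.eq_empty_iff_forall_notMem]
      rintro P ⟨hP, hdim, hext⟩
      obtain ⟨V, -, ⟨a, ha⟩, W, -, h⟩ := SdpCount.setup P hP hdim hext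
      obtain ⟨U, -, hU⟩ := h (AffineMap.const ℝ _ 1) (fun w _ => by simp) (1 / 2) (by norm_num)
      have h1 := hU a ha
      have h2 : ∑ k, (U k * W a k).trace = 0 := by
        have : l = 0 ∨ m = 0 := by
          rcases Nat.mul_eq_zero.1 hn with h | h
          · exact Nat.mul_eq_zero.1 h
          · exact Or.inr h
        rcases this with h | h
        · subst h; simp
        · subst h; simp
      rw [h2] at h1
      norm_num at h1
    rw [hempty]
    simp
  have hn1 : 1 ≤ l * m * m := Nat.one_le_iff_ne_zero.2 hn
  rcases le_or_gt (2 ^ d) (32 * l ^ 2 * m ^ 4 * d ^ 2) with hbig | hbig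
  · obtain ⟨h1, h2⟩ := SdpCount.ncard_of_code (C := Set (Fin d → Bool))
      {P : Set (EuclideanSpace ℝ (Fin d)) | IsZeroOnePolytope P ∧
        1 ≤ Module.finrank ℝ (affineSpan ℝ P).direction ∧ HasSdpExtBlocks P l m}
      (fun P V => P = convexHull ℝ (SdpCount.pt '' V))
      (fun P hP => by
        obtain ⟨V, hV, -⟩ := SdpCount.setup P hP.1 hP.2.1 hP.2.2
        exact ⟨V, hV⟩)
      (fun P P' c h h' => h.trans h'.symm)
    refine ⟨h1, h2.trans ?_⟩
    rw [Fintype.card_set]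
    simp only [Fintype.card_fun, Fintype.card_bool, Fintype.card_fin]
    exact Nat.pow_le_pow_right (by norm_num) hbig
  · obtain ⟨hN, hcard⟩ := SdpCount.card_arith d l m hd hn1 hbig
    obtain ⟨r, hr⟩ := SdpCount.round _ d _ (by positivity) hN
    have hDpos : (1 : ℝ) ≤ ((1 + d + l * m * m : ℕ) : ℝ) := by
      exact_mod_cast (by omega : 1 ≤ 1 + d + l * m * m)
    obtain ⟨h1, h2⟩ := SdpCount.ncard_of_code
      (C := SdpCount.Code d l m (1 + d + l * m * m) (2 ^ (2 * d)))
      {P : Set (EuclideanSpace ℝ (Fin d)) | IsZeroOnePolytope P ∧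
        1 ≤ Module.finrank ℝ (affineSpan ℝ P).direction ∧ HasSdpExtBlocks P l m}
      (SdpCount.Good (1 / (4 * ((1 + d + l * m * m : ℕ) : ℝ))) r)
      (fun P hP => SdpCount.good_exists le_rfl _ (by positivity)
        (by apply one_div_le_one_div_of_le <;> linarith) r P hP.1 hP.2.1 hP.2.2)
      (fun P P' c h h' => SdpCount.good_inj hr (by
        have hn2 : (1 : ℝ) ≤ (l * m * m : ℝ) := by exact_mod_cast hn1
        have hp : (0 : ℝ) < 2 ^ d := by positivity
        have h4 : (4 * (1 + d + l * m * m) * (l * m * m) * 2 ^ d : ℕ)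
          = (4 * ((1 + d + l * m * m : ℕ) : ℝ) * (l * m * m : ℝ) * 2 ^ d) := by push_cast; ring
        rw [h4]
        generalize ((1 + d + l * m * m : ℕ) : ℝ) = D at *
        generalize (l * m * m : ℝ) = n at *
        generalize (2 : ℝ) ^ d = p at *
        have : D * (1 / (4 * D) + n * (1 / (4 * D * n * p) * p)) = 1 / 2 := by
          field_simp; norm_num
        rw [this]; norm_num) h h')
    exact ⟨h1, h2.trans hcard⟩
end
end
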